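/- arXiv:2504.08147 — 2 statements merged into one kernel-verified Lean document; each statement's English description precedes it below -/
import Mathlib

section
/- Let n ≥ 3 and let σ be a nonzero nonnegative Borel measure on ℝⁿ that is finite on bounded sets and satisfies condition (A). Then there exists a Borel function u : ℝⁿ → [0,∞] such that σ({x : u(x) > 0}) > 0, ∫_{ℝⁿ} F(u) dσ < ∞, and u(x) = W_G((f∘u)·dσ)(x) for every x ∈ ℝⁿ, where (f∘u)·dσ is the measure with density f∘u with respect to σ. -/
open MeasureTheory Metric Set
open scoped ENNReal

noncomputable def gfun (p q : ℝ) (t : ℝ≥0∞) : ℝ≥0∞ := t ^ (p - 1) + t ^ (q - 1)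

noncomputable def ffun (p q γ : ℝ) (t : ℝ≥0∞) : ℝ≥0∞ :=
  t ^ ((p - 1) * γ) + t ^ ((q - 1) * γ)

noncomputable def Ffun (p q γ : ℝ) (t : ℝ≥0∞) : ℝ≥0∞ :=
  t ^ ((p - 1) * γ + 1) / ENNReal.ofReal ((p - 1) * γ + 1)
    + t ^ ((q - 1) * γ + 1) / ENNReal.ofReal ((q - 1) * γ + 1)

/-- The Wolff-type potential `W_G σ(x) = ∫₀^∞ h(σ(B(x,t))/t^(n−1)) dt`,
where `h` is the inverse of `g`. -/
noncomputable def wolffG (n : ℕ) (h : ℝ≥0∞ → ℝ≥0∞)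
    (σ : Measure (EuclideanSpace ℝ (Fin n))) (x : EuclideanSpace ℝ (Fin n)) : ℝ≥0∞ :=
  ∫⁻ t in Set.Ioi (0 : ℝ), h (σ (ball x t) / ENNReal.ofReal t ^ (n - 1))

/-- The classical Wolff potential `W_s σ(x) = ∫₀^∞ (σ(B(x,t))/t^(n−1))^(1/(s−1)) dt`. -/
noncomputable def wolffS (n : ℕ) (s : ℝ)
    (σ : Measure (EuclideanSpace ℝ (Fin n))) (x : EuclideanSpace ℝ (Fin n)) : ℝ≥0∞ :=
  ∫⁻ t in Set.Ioi (0 : ℝ), (σ (ball x t) / ENNReal.ofReal t ^ (n - 1)) ^ (1 / (s - 1))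

/-- Condition (A) on the measure σ. -/
def condA (n : ℕ) (p q γ : ℝ) (σ : Measure (EuclideanSpace ℝ (Fin n))) : Prop :=
  ∀ s ∈ ({p, q} : Set ℝ),
    ∀ θ ∈ ({1 / (1 - γ), (p - 1) / (p - 1 - γ * (q - 1)),
            (q - 1) / (q - 1 - γ * (p - 1))} : Set ℝ),
      (∫⁻ x, Ffun p q γ ((wolffS n s σ x) ^ θ) ∂σ) < ⊤

/-- The centred maximal function of `ν` relative to `μ`, taken over balls of rational radius. -/
noncomputable def ballMaximal {α : Type*} [PseudoMetricSpace α] [MeasurableSpace α]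
    (μ ν : Measure α) (x : α) : ℝ≥0∞ :=
  ⨆ t : ℚ, ν (ball x t) / μ (ball x t)

lemma measurable_measure_ball {α : Type*} [PseudoMetricSpace α] [SecondCountableTopology α]
    [MeasurableSpace α] [OpensMeasurableSpace α] (μ : Measure α) [SFinite μ] :
    Measurable fun z : α × ℝ => μ (ball z.1 z.2) := by
  have hs : MeasurableSet {w : (α × ℝ) × α | dist w.2 w.1.1 < w.1.2} :=
    measurableSet_lt (by fun_prop) (by fun_prop)
  exact measurable_measure_prodMk_left hs

lemma measurable_ballMaximal {α : Type*} [PseudoMetricSpace α] [SecondCountableTopology α]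
    [MeasurableSpace α] [OpensMeasurableSpace α] (μ ν : Measure α) [SFinite μ] [SFinite ν] :
    Measurable (ballMaximal μ ν) := by
  have key (ρ : Measure α) [SFinite ρ] (t : ℚ) : Measurable fun x => ρ (ball x t) :=
    (measurable_measure_ball ρ).comp (measurable_id.prodMk measurable_const)
  exact .iSup fun t => (key ν t).div (key μ t)

lemma measure_ball_eq_iSup {α : Type*} [PseudoMetricSpace α] [MeasurableSpace α]
    (ν : Measure α) (x : α) (t : ℝ) :
    ν (ball x t) = ⨆ s : {s : ℚ // (s : ℝ) < t}, ν (ball x (s : ℚ)) := by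
  have hset : ball x t = ⋃ s : {s : ℚ // (s : ℝ) < t}, ball x (s : ℚ) := by
    ext y
    simp only [mem_ball, mem_iUnion, Subtype.exists, exists_prop]
    constructor
    · intro hy
      obtain ⟨s, h1, h2⟩ := exists_rat_btwn hy
      exact ⟨s, h2, h1⟩
    · rintro ⟨s, h1, h2⟩
      exact h2.trans h1
  conv_lhs => rw [hset]
  refine Directed.measure_iUnion (Monotone.directed_le fun a b hab => ball_subset_ball ?_)
  exact_mod_cast hab

lemma measure_ball_le_ballMaximal_mul {α : Type*} [PseudoMetricSpace α] [MeasurableSpace α]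
    {μ ν : Measure α} (hν : ν ≪ μ) (hμ : ∀ x r, μ (ball x r) < ⊤) (x : α) (t : ℝ) :
    ν (ball x t) ≤ ballMaximal μ ν x * μ (ball x t) := by
  rw [measure_ball_eq_iSup ν x t]
  refine iSup_le fun s => ?_
  have h1 : ν (ball x (s : ℚ)) ≤ ballMaximal μ ν x * μ (ball x (s : ℚ)) := by
    by_cases h0 : μ (ball x (s : ℚ)) = 0
    · simp [hν h0]
    · rw [← ENNReal.div_le_iff h0 (hμ _ _).ne]
      exact le_iSup (fun t : ℚ => ν (ball x t) / μ (ball x t)) (s : ℚ)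
  exact h1.trans (by gcongr; exact s.2.le)

/-- Weak type `(1,1)` estimate for the centred maximal function. -/
lemma exists_mul_measure_lt_ballMaximal_le (α : Type*) [MetricSpace α]
    [SecondCountableTopology α] [MeasurableSpace α] [OpensMeasurableSpace α]
    [HasBesicovitchCovering α] :
    ∃ N : ℕ, ∀ (μ ν : Measure α) (c : ℝ≥0∞),
      c * μ {x | c < ballMaximal μ ν x} ≤ N * ν univ := by
  obtain ⟨N, τ, hτ, hN⟩ := HasBesicovitchCovering.no_satelliteConfig (α := α)
  refine ⟨N, fun μ ν c => ?_⟩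
  let S : ℕ → Set α := fun R =>
    {x | ∃ t : ℝ, 0 < t ∧ t ≤ R ∧ c * μ (ball x t) ≤ ν (ball x t)}
  have hS : ∀ R, c * μ (S R) ≤ N * ν univ := by
    intro R
    choose r hr0 hrR hr using fun x : S R => x.2
    let P : Besicovitch.BallPackage (S R) α :=
      { c := fun x => x, r := r, rpos := hr0, r_bound := R, r_le := hrR }
    obtain ⟨s, hdisj, hcov⟩ := Besicovitch.exist_disjoint_covering_families hτ hN P
    have hdisj' (i) : (s i).PairwiseDisjoint fun j => ball (P.c j) (P.r j) :=
      (hdisj i).mono fun _ => ball_subset_closedBall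
    have hcount (i) : (s i).Countable :=
      (hdisj' i).countable_of_isOpen (fun _ _ => isOpen_ball)
        fun j _ => nonempty_ball.2 (P.rpos j)
    have hrange : range P.c = S R := Subtype.range_coe
    calc c * μ (S R) ≤ c * ∑ i, μ (⋃ j ∈ s i, ball (P.c j) (P.r j)) := by
          gcongr
          exact (measure_mono (hrange.ge.trans hcov)).trans (measure_iUnion_fintype_le _ _)
      _ = ∑ i, c * μ (⋃ j ∈ s i, ball (P.c j) (P.r j)) := Finset.mul_sum _ _ _
      _ ≤ ∑ i : Fin N, ν univ := by
          refine Finset.sum_le_sum fun i _ => ?_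
          rw [measure_biUnion (hcount i) (hdisj' i) fun _ _ => measurableSet_ball,
            ← ENNReal.tsum_mul_left]
          refine (ENNReal.tsum_le_tsum fun j : s i => hr j).trans ?_
          rw [← measure_biUnion (μ := ν) (hcount i) (hdisj' i) fun _ _ => measurableSet_ball]
          exact measure_mono (subset_univ _)
      _ = N * ν univ := by simp
  have hmono : Monotone S := by
    rintro a b hab x ⟨t, h0, h1, h2⟩
    exact ⟨t, h0, h1.trans (by exact_mod_cast hab), h2⟩
  have hsub : {x | c < ballMaximal μ ν x} ⊆ ⋃ R, S R := by
    intro x hx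
    obtain ⟨t, ht⟩ := lt_iSup_iff.1 (show c < ⨆ t : ℚ, _ from hx)
    obtain ⟨R, hR⟩ := exists_nat_ge (t : ℝ)
    refine mem_iUnion.2 ⟨R, t, ?_, hR, (ENNReal.mul_lt_of_lt_div ht).le⟩
    by_contra! h0
    simp [ball_eq_empty.2 h0] at ht
  calc c * μ {x | c < ballMaximal μ ν x} ≤ c * μ (⋃ R, S R) := by gcongr
    _ = ⨆ R, c * μ (S R) := by rw [hmono.measure_iUnion, ENNReal.mul_iSup]
    _ ≤ N * ν univ := iSup_le hS

lemma lintegral_Ioi_indicator_rpow {s : ℝ} (hs : 0 < s) (y : ℝ≥0∞) :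
    ∫⁻ t in Ioi (0 : ℝ),
      {t : ℝ | ENNReal.ofReal t < y}.indicator (fun t => ENNReal.ofReal t ^ (s - 1)) t
      = y ^ s / ENNReal.ofReal s := by
  have hmeas (y : ℝ≥0∞) : MeasurableSet {t : ℝ | ENNReal.ofReal t < y} :=
    measurableSet_lt (by fun_prop) (by fun_prop)
  have hfin (a : NNReal) : ∫⁻ t in Ioi (0 : ℝ),
      {t : ℝ | ENNReal.ofReal t < a}.indicator (fun t => ENNReal.ofReal t ^ (s - 1)) t
      = (a : ℝ≥0∞) ^ s / ENNReal.ofReal s := by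
    have hset : {t : ℝ | ENNReal.ofReal t < a} ∩ Ioi 0 = Ioo 0 (a : ℝ) := by
      ext t
      simp only [mem_inter_iff, mem_ofPred_eq, mem_Ioi, mem_Ioo]
      constructor
      · rintro ⟨h1, h2⟩
        exact ⟨h2, by rwa [ENNReal.ofReal_lt_coe_iff h2.le] at h1⟩
      · rintro ⟨h1, h2⟩
        exact ⟨by rwa [ENNReal.ofReal_lt_coe_iff h1.le], h1⟩
    rw [lintegral_indicator (hmeas a), Measure.restrict_restrict (hmeas a), hset,
      Measure.restrict_congr_set Ioo_ae_eq_Ioc]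
    have ha0 : (0 : ℝ) ≤ a := a.2
    have hint : IntegrableOn (fun t : ℝ => t ^ (s - 1)) (Ioc 0 (a : ℝ)) := by
      rw [← intervalIntegrable_iff_integrableOn_Ioc_of_le ha0]
      exact intervalIntegral.intervalIntegrable_rpow' (by linarith)
    have hval : ∫ t in Ioc 0 (a : ℝ), t ^ (s - 1) = (a : ℝ) ^ s / s := by
      rw [← intervalIntegral.integral_of_le ha0, integral_rpow (Or.inl (by linarith))]
      simp [Real.zero_rpow hs.ne']
    have h1 : ∫⁻ t in Ioc 0 (a : ℝ), ENNReal.ofReal t ^ (s - 1)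
        = ∫⁻ t in Ioc 0 (a : ℝ), ENNReal.ofReal (t ^ (s - 1)) :=
      setLIntegral_congr_fun measurableSet_Ioc fun t ht => ENNReal.ofReal_rpow_of_pos ht.1
    rw [h1, ← ofReal_integral_eq_lintegral_ofReal hint, hval, ENNReal.ofReal_div_of_pos hs,
      ← ENNReal.ofReal_rpow_of_nonneg ha0 hs.le]
    · simp
    · filter_upwards [ae_restrict_mem measurableSet_Ioc] with t ht
      exact Real.rpow_nonneg ht.1.le _
  induction y with
  | coe a => exact hfin a
  | top =>
    rw [ENNReal.top_rpow_of_pos hs, ENNReal.top_div_of_ne_top ENNReal.ofReal_ne_top]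
    refine top_unique (le_of_forall_lt fun b hb => ?_)
    lift b to NNReal using hb.ne
    have hs0 : ENNReal.ofReal s ≠ 0 := by simpa using hs
    let a : NNReal := ((b + 1) * s.toNNReal) ^ s⁻¹
    have ha : (a : ℝ≥0∞) ^ s / ENNReal.ofReal s = b + 1 := by
      have h1 : a ^ s = (b + 1) * s.toNNReal := NNReal.rpow_inv_rpow hs.ne' _
      rw [← ENNReal.coe_rpow_of_nonneg _ hs.le, h1, ENNReal.coe_mul]
      exact (ENNReal.mul_div_cancel_right hs0 ENNReal.ofReal_ne_top).trans (by simp)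
    calc (b : ℝ≥0∞) < b + 1 := by exact_mod_cast lt_add_one b
      _ = _ := ha.symm
      _ = _ := (hfin a).symm
      _ ≤ _ := by
        gcongr with t
        exact le_top

/-- The centred maximal function is bounded on `L^r` for `1 < r`. -/
lemma exists_lintegral_ballMaximal_rpow_le (α : Type*) [MetricSpace α]
    [SecondCountableTopology α] [MeasurableSpace α] [OpensMeasurableSpace α]
    [HasBesicovitchCovering α] {r : ℝ} (hr : 1 < r) :
    ∃ C : ℝ≥0∞, C ≠ ⊤ ∧ ∀ (μ : Measure α) [SFinite μ] (g : α → ℝ≥0∞), Measurable g →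
      ∫⁻ x, ballMaximal μ (μ.withDensity g) x ^ r ∂μ ≤ C * ∫⁻ x, g x ^ r ∂μ := by
  obtain ⟨N, hN⟩ := exists_mul_measure_lt_ballMaximal_le α
  have hr0 : 0 < r := by linarith
  have hr1 : 0 < r - 1 := by linarith
  have hofr : ENNReal.ofReal r ≠ 0 := by simpa using hr0
  refine ⟨ENNReal.ofReal r * (2 * N * (2 ^ (r - 1) / ENNReal.ofReal (r - 1))), ?_, ?_⟩
  · have : ENNReal.ofReal (r - 1) ≠ 0 := by simpa using hr1
    finiteness
  intro μ _ g hg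
  set M := ballMaximal μ (μ.withDensity g) with hMdef
  have hM : Measurable M := measurable_ballMaximal _ _
  have hdist : ∀ t : ℝ, 0 < t → μ {x | ENNReal.ofReal t < M x} * ENNReal.ofReal t ^ (r - 1) ≤
      2 * N * ∫⁻ x, {x | ENNReal.ofReal t < 2 * g x}.indicator g x *
        ENNReal.ofReal t ^ (r - 1 - 1) ∂μ := by
    intro t ht
    have hset : MeasurableSet {x | ENNReal.ofReal t < 2 * g x} :=
      measurableSet_lt (by fun_prop) (by fun_prop)
    set c : ℝ≥0∞ := ENNReal.ofReal t / 2 with hc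
    have hcc : c + c = ENNReal.ofReal t := ENNReal.add_halves _
    have hctop : c ≠ ⊤ := by finiteness
    set g' := {x | ENNReal.ofReal t < 2 * g x}.indicator g with hg'
    have hgle : ∀ x, g x ≤ g' x + c := by
      intro x
      by_cases hx : ENNReal.ofReal t < 2 * g x
      · rw [hg', indicator_of_mem (by exact hx)]
        exact le_self_add
      · rw [hg', indicator_of_notMem (by exact hx), zero_add, hc,
          ENNReal.le_div_iff_mul_le (by simp) (by simp), mul_comm]
        exact not_lt.1 hx
    have hMle : ∀ x, M x ≤ ballMaximal μ (μ.withDensity g') x + c := by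
      intro x
      refine iSup_le fun s => ?_
      have h1 : μ.withDensity g (ball x s) ≤ μ.withDensity g' (ball x s) + c * μ (ball x s) := by
        rw [withDensity_apply _ measurableSet_ball, withDensity_apply _ measurableSet_ball,
          ← setLIntegral_const, ← lintegral_add_right _ measurable_const]
        exact lintegral_mono fun y => hgle y
      calc _ ≤ (μ.withDensity g' (ball x s) + c * μ (ball x s)) / μ (ball x s) := by gcongr
        _ = μ.withDensity g' (ball x s) / μ (ball x s) + c * (μ (ball x s) / μ (ball x s)) := by
          rw [ENNReal.add_div, mul_div_assoc]
        _ ≤ ballMaximal μ (μ.withDensity g') x + c * 1 := by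
          gcongr
          · exact le_iSup (fun s : ℚ => μ.withDensity g' (ball x s) / μ (ball x s)) s
          · exact ENNReal.div_self_le_one
        _ = _ := by rw [mul_one]
    have hsub : {x | ENNReal.ofReal t < M x} ⊆
        {x | c < ballMaximal μ (μ.withDensity g') x} := by
      intro x hx
      have h1 : c + c < ballMaximal μ (μ.withDensity g') x + c := by
        rw [hcc]
        exact hx.trans_le (hMle x)
      exact lt_of_add_lt_add_right h1
    have ht0 : ENNReal.ofReal t ≠ 0 := by simpa using ht
    have hweak : ENNReal.ofReal t * μ {x | ENNReal.ofReal t < M x} ≤ 2 * N * ∫⁻ x, g' x ∂μ := by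
      calc ENNReal.ofReal t * μ {x | ENNReal.ofReal t < M x}
          = 2 * (c * μ {x | ENNReal.ofReal t < M x}) := by rw [← hcc]; ring
        _ ≤ 2 * (c * μ {x | c < ballMaximal μ (μ.withDensity g') x}) := by gcongr
        _ ≤ 2 * (N * μ.withDensity g' univ) := by exact mul_le_mul_right (hN _ _ _) _
        _ = 2 * N * ∫⁻ x, g' x ∂μ := by
          rw [withDensity_apply _ .univ, Measure.restrict_univ, mul_assoc]
    have hpow : ENNReal.ofReal t ^ (r - 1)
        = ENNReal.ofReal t * ENNReal.ofReal t ^ (r - 1 - 1) := by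
      conv_rhs => rw [← ENNReal.rpow_one (ENNReal.ofReal t), ← ENNReal.rpow_mul, one_mul]
      rw [← ENNReal.rpow_add _ _ ht0 ENNReal.ofReal_ne_top, add_sub_cancel]
    rw [hpow, lintegral_mul_const _ (hg.indicator hset), ← mul_assoc, ← mul_assoc,
      mul_comm (μ _)]
    gcongr
  have hind : MeasurableSet {z : α × ℝ | ENNReal.ofReal z.2 < M z.1} :=
    measurableSet_lt (by fun_prop) (by fun_prop)
  have hind' : MeasurableSet {z : α × ℝ | ENNReal.ofReal z.2 < 2 * g z.1} :=
    measurableSet_lt (by fun_prop) (by fun_prop)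
  calc ∫⁻ x, M x ^ r ∂μ
      = ∫⁻ x, ENNReal.ofReal r * (∫⁻ t in Ioi (0 : ℝ),
          {t : ℝ | ENNReal.ofReal t < M x}.indicator
            (fun t => ENNReal.ofReal t ^ (r - 1)) t) ∂μ := by
        refine lintegral_congr fun x => ?_
        rw [lintegral_Ioi_indicator_rpow hr0, ENNReal.mul_div_cancel hofr ENNReal.ofReal_ne_top]
    _ = ENNReal.ofReal r * ∫⁻ x, (∫⁻ t in Ioi (0 : ℝ),
          {t : ℝ | ENNReal.ofReal t < M x}.indicator
            (fun t => ENNReal.ofReal t ^ (r - 1)) t) ∂μ :=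
        lintegral_const_mul' _ _ ENNReal.ofReal_ne_top
    _ = ENNReal.ofReal r * ∫⁻ t in Ioi (0 : ℝ), ∫⁻ x,
          {t : ℝ | ENNReal.ofReal t < M x}.indicator
            (fun t => ENNReal.ofReal t ^ (r - 1)) t ∂μ := by
        rw [lintegral_lintegral_swap]
        refine Measurable.aemeasurable ?_
        exact Measurable.indicator (f := fun z : α × ℝ => ENNReal.ofReal z.2 ^ (r - 1))
          (by fun_prop) hind
    _ ≤ ENNReal.ofReal r * ∫⁻ t in Ioi (0 : ℝ), 2 * N *
          ∫⁻ x, {x | ENNReal.ofReal t < 2 * g x}.indicator g x *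
            ENNReal.ofReal t ^ (r - 1 - 1) ∂μ := by
        gcongr ENNReal.ofReal r * ?_
        refine setLIntegral_mono' measurableSet_Ioi fun t ht => le_trans (le_of_eq ?_) (hdist t ht)
        have : ∀ x, {t : ℝ | ENNReal.ofReal t < M x}.indicator
            (fun t => ENNReal.ofReal t ^ (r - 1)) t = {x | ENNReal.ofReal t < M x}.indicator
            (fun _ => ENNReal.ofReal t ^ (r - 1)) x := fun x => by simp [indicator_apply]
        simp_rw [this]
        rw [lintegral_indicator_const (measurableSet_lt (by fun_prop) (by fun_prop)), mul_comm]
    _ = ENNReal.ofReal r * (2 * N * ∫⁻ x, (∫⁻ t in Ioi (0 : ℝ),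
          {x | ENNReal.ofReal t < 2 * g x}.indicator g x *
            ENNReal.ofReal t ^ (r - 1 - 1)) ∂μ) := by
        rw [lintegral_const_mul' _ _ (by finiteness), lintegral_lintegral_swap]
        refine Measurable.aemeasurable ?_
        have := Measurable.indicator (f := fun z : ℝ × α => g z.2)
          (by fun_prop) (hind'.preimage measurable_swap)
        exact this.mul (f := fun z : ℝ × α => _) (by fun_prop)
    _ = ENNReal.ofReal r * (2 * N * ∫⁻ x,
          2 ^ (r - 1) / ENNReal.ofReal (r - 1) * g x ^ r ∂μ) := by
        congr 2
        refine lintegral_congr fun x => ?_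
        have : ∀ t : ℝ, {x | ENNReal.ofReal t < 2 * g x}.indicator g x *
            ENNReal.ofReal t ^ (r - 1 - 1) = g x * {t : ℝ | ENNReal.ofReal t < 2 * g x}.indicator
            (fun t => ENNReal.ofReal t ^ (r - 1 - 1)) t := fun t => by
          simp only [indicator_apply, mem_ofPred_eq]
          split_ifs <;> simp
        simp_rw [this]
        rw [lintegral_const_mul _ (Measurable.indicator (by fun_prop)
          (measurableSet_lt (by fun_prop) (by fun_prop))), lintegral_Ioi_indicator_rpow hr1,
          ENNReal.mul_rpow_of_nonneg _ _ hr1.le]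
        have hp : g x ^ r = g x * g x ^ (r - 1) := by
          conv_rhs => rw [← ENNReal.rpow_one (g x), ← ENNReal.rpow_mul, one_mul]
          rw [← ENNReal.rpow_add_of_nonneg _ _ zero_le_one hr1.le, add_sub_cancel]
        rw [hp, div_eq_mul_inv, div_eq_mul_inv]
        ring
    _ = _ := by
        rw [lintegral_const_mul _ (by fun_prop)]
        ring

/-- By Hölder's inequality the averages of `u ^ a`, `a ≤ b`, are controlled by the maximal
function of `u ^ b`. -/
lemma withDensity_rpow_ball_le {α : Type*} [PseudoMetricSpace α] [MeasurableSpace α]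
    [OpensMeasurableSpace α] {μ : Measure α} (hμ : ∀ x r, μ (ball x r) < ⊤) {a b : ℝ}
    (ha : 0 < a) (hab : a ≤ b) {u : α → ℝ≥0∞} (hu : Measurable u) (x : α) (t : ℝ) :
    μ.withDensity (fun y => u y ^ a) (ball x t) ≤
      (ballMaximal μ (μ.withDensity fun y => u y ^ b) x ^ (1 / b)) ^ a * μ (ball x t) := by
  have hb : 0 < b := ha.trans_le hab
  set M := ballMaximal μ (μ.withDensity fun y => u y ^ b) x
  have hM : μ.withDensity (fun y => u y ^ b) (ball x t) ≤ M * μ (ball x t) :=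
    measure_ball_le_ballMaximal_mul (withDensity_absolutelyContinuous _ _) hμ x t
  rcases hab.eq_or_lt with rfl | hlt
  · rwa [← ENNReal.rpow_mul, one_div_mul_cancel ha.ne', ENNReal.rpow_one]
  have hconj : (b / a).HolderConjugate (b / a).conjExponent :=
    Real.HolderConjugate.conjExponent ((one_lt_div ha).2 hlt)
  have hinv : 1 / (b / a).conjExponent = 1 - a / b := by
    rw [one_div, ← hconj.one_sub_inv, inv_div]
  have hab1 : 0 ≤ 1 - a / b := by
    rw [sub_nonneg, div_le_one hb]; exact hab
  have hab0 : 0 ≤ a / b := by positivity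
  rw [withDensity_apply _ measurableSet_ball] at hM ⊢
  calc ∫⁻ y in ball x t, u y ^ a ∂μ
      ≤ (∫⁻ y in ball x t, u y ^ b ∂μ) ^ (a / b) * μ (ball x t) ^ (1 - a / b) := by
        have := ENNReal.lintegral_mul_le_Lp_mul_Lq (μ.restrict (ball x t)) hconj
          (f := fun y => u y ^ a) (g := fun _ => 1) (by fun_prop) (by fun_prop)
        simpa [hinv, ← ENNReal.rpow_mul, mul_div_cancel₀ b ha.ne'] using this
    _ ≤ (M * μ (ball x t)) ^ (a / b) * μ (ball x t) ^ (1 - a / b) := by gcongr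
    _ = _ := by
      rw [ENNReal.mul_rpow_of_nonneg _ _ hab0, mul_assoc,
        ← ENNReal.rpow_add_of_nonneg _ _ hab0 hab1, add_sub_cancel, ENNReal.rpow_one,
        ← ENNReal.rpow_mul, one_div_mul_eq_div]

lemma exists_rpow_mul_rpow_le {γ : ℝ} (hγ0 : 0 < γ) (hγ1 : γ < 1) {ε : ℝ≥0∞} (hε : ε ≠ 0)
    (hε' : ε ≠ ⊤) {r : ℝ} (hr : 0 < r) :
    ∃ K : ℝ≥0∞, K ≠ ⊤ ∧ ∀ w W : ℝ≥0∞,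
      (w ^ γ * W) ^ r ≤ ε * w ^ r + K * (W ^ (1 / (1 - γ))) ^ r := by
  have hγ1' : 0 < 1 - γ := by linarith
  have hconj : (1 / γ).HolderConjugate (1 / (1 - γ)) := by
    rw [Real.holderConjugate_iff]
    refine ⟨(one_lt_div hγ0).2 hγ1, by simp⟩
  refine ⟨(ε ^ (-γ)) ^ (1 / (1 - γ)), by finiteness, fun w W => ?_⟩
  have hdiv : ∀ {s : ℝ}, 1 ≤ s → ∀ z : ℝ≥0∞, z / ENNReal.ofReal s ≤ z := fun hs z =>
    ENNReal.div_le_of_le_mul (le_mul_of_one_le_right' (by simpa using hs))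
  calc (w ^ γ * W) ^ r = (ε * w ^ r) ^ γ * (ε ^ (-γ) * W ^ r) := by
        rw [ENNReal.mul_rpow_of_nonneg _ _ hr.le, ENNReal.mul_rpow_of_nonneg _ _ hγ0.le,
          mul_mul_mul_comm, ← ENNReal.rpow_add _ _ hε hε', add_neg_cancel, ENNReal.rpow_zero,
          one_mul, ← ENNReal.rpow_mul, ← ENNReal.rpow_mul, mul_comm γ]
    _ ≤ ((ε * w ^ r) ^ γ) ^ (1 / γ) / ENNReal.ofReal (1 / γ) +
          (ε ^ (-γ) * W ^ r) ^ (1 / (1 - γ)) / ENNReal.ofReal (1 / (1 - γ)) :=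
        ENNReal.young_inequality _ _ hconj
    _ ≤ ((ε * w ^ r) ^ γ) ^ (1 / γ) + (ε ^ (-γ) * W ^ r) ^ (1 / (1 - γ)) :=
        add_le_add (hdiv hconj.lt.le _) (hdiv hconj.symm.lt.le _)
    _ = _ := by
        rw [← ENNReal.rpow_mul, mul_one_div_cancel hγ0.ne', ENNReal.rpow_one,
          ENNReal.mul_rpow_of_nonneg _ _ (by positivity : 0 ≤ 1 / (1 - γ)),
          ← ENNReal.rpow_mul W, ← ENNReal.rpow_mul W, mul_comm r]

lemma strictMono_gfun {p q : ℝ} (hp : 1 < p) (hpq : p < q) :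
    StrictMono (gfun p q) := fun _ _ h =>
  ENNReal.add_lt_add (ENNReal.strictMono_rpow_of_pos (by linarith) h)
    (ENNReal.strictMono_rpow_of_pos (by linarith) h)

/-- `gfun p q` as an order isomorphism with a given inverse. -/
noncomputable def gfunIso {p q : ℝ} (hp : 1 < p) (hpq : p < q) {h : ℝ≥0∞ → ℝ≥0∞}
    (hhg : ∀ s, gfun p q (h s) = s) :
    ℝ≥0∞ ≃o ℝ≥0∞ :=
  (strictMono_gfun hp hpq).orderIsoOfRightInverse _ h hhg

lemma monotone_of_gfun_inverse {p q : ℝ} (hp : 1 < p) (hpq : p < q) {h : ℝ≥0∞ → ℝ≥0∞}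
    (hhg : ∀ s, gfun p q (h s) = s) : Monotone h :=
  (gfunIso hp hpq hhg).symm.monotone

lemma map_iSup_of_gfun_inverse {p q : ℝ} (hp : 1 < p) (hpq : p < q) {h : ℝ≥0∞ → ℝ≥0∞}
    (hhg : ∀ s, gfun p q (h s) = s) {ι : Sort*} (v : ι → ℝ≥0∞) :
    h (⨆ i, v i) = ⨆ i, h (v i) :=
  (gfunIso hp hpq hhg).symm.map_iSup v

lemma gfun_inverse_le_iff {p q : ℝ} (hp : 1 < p) (hpq : p < q) {h : ℝ≥0∞ → ℝ≥0∞}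
    (hhg : ∀ s, gfun p q (h s) = s) {s t : ℝ≥0∞} : h s ≤ t ↔ s ≤ gfun p q t :=
  (gfunIso hp hpq hhg).symm_apply_le

lemma le_gfun_inverse_iff {p q : ℝ} (hp : 1 < p) (hpq : p < q) {h : ℝ≥0∞ → ℝ≥0∞}
    (hhg : ∀ s, gfun p q (h s) = s) {s t : ℝ≥0∞} : t ≤ h s ↔ gfun p q t ≤ s :=
  (gfunIso hp hpq hhg).le_symm_apply

lemma gfun_inverse_mul_le {p q : ℝ} (hp : 1 < p) (hpq : p < q) {h : ℝ≥0∞ → ℝ≥0∞}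
    (hhg : ∀ s, gfun p q (h s) = s) (y s : ℝ≥0∞) :
    h (gfun p q y * s) ≤ y * (s ^ (1 / (p - 1)) + s ^ (1 / (q - 1))) := by
  have hP : 0 < p - 1 := by linarith
  have hQ : 0 < q - 1 := by linarith
  rw [gfun_inverse_le_iff hp hpq hhg, gfun, gfun, add_mul, ENNReal.mul_rpow_of_nonneg _ _ hP.le,
    ENNReal.mul_rpow_of_nonneg _ _ hQ.le]
  gcongr
  · calc s = (s ^ (1 / (p - 1))) ^ (p - 1) := by
          rw [← ENNReal.rpow_mul, one_div_mul_cancel hP.ne', ENNReal.rpow_one]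
      _ ≤ _ := by gcongr; exact le_self_add
  · calc s = (s ^ (1 / (q - 1))) ^ (q - 1) := by
          rw [← ENNReal.rpow_mul, one_div_mul_cancel hQ.ne', ENNReal.rpow_one]
      _ ≤ _ := by gcongr; exact le_add_self

lemma ffun_eq_gfun (p q γ : ℝ) (t : ℝ≥0∞) : ffun p q γ t = gfun p q (t ^ γ) := by
  simp only [ffun, gfun, ← ENNReal.rpow_mul, mul_comm γ]

lemma monotone_ffun {p q γ : ℝ} (hp : 1 < p) (hpq : p < q) (hγ : 0 < γ) :
    Monotone (ffun p q γ) := fun a b hab => by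
  simp only [ffun_eq_gfun]
  exact (strictMono_gfun hp hpq).monotone (by gcongr)

lemma measurable_ffun (p q γ : ℝ) : Measurable (ffun p q γ) := by
  unfold ffun
  fun_prop

lemma ffun_iSup {p q γ : ℝ} (hp : 1 < p) (hpq : p < q) (hγ : 0 < γ) {h : ℝ≥0∞ → ℝ≥0∞}
    (hhg : ∀ s, gfun p q (h s) = s) {ι : Sort*} (v : ι → ℝ≥0∞) :
    ffun p q γ (⨆ i, v i) = ⨆ i, ffun p q γ (v i) := by
  simp only [ffun_eq_gfun]
  have h1 : (⨆ i, v i) ^ γ = ⨆ i, v i ^ γ := (ENNReal.orderIsoRpow γ hγ).map_iSup v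
  rw [h1]
  exact (gfunIso hp hpq hhg).map_iSup _

lemma measurable_wolffG {n : ℕ} {h : ℝ≥0∞ → ℝ≥0∞} (hh : Monotone h)
    (ν : Measure (EuclideanSpace ℝ (Fin n))) [SFinite ν] : Measurable (wolffG n h ν) := by
  refine Measurable.lintegral_prod_right'
    (f := fun z : EuclideanSpace ℝ (Fin n) × ℝ =>
      h (ν (ball z.1 z.2) / ENNReal.ofReal z.2 ^ (n - 1))) ?_
  exact hh.measurable.comp ((measurable_measure_ball ν).div (by fun_prop))

lemma measurable_wolffG_integrand {n : ℕ} {h : ℝ≥0∞ → ℝ≥0∞} (hh : Monotone h)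
    (ν : Measure (EuclideanSpace ℝ (Fin n))) (x : EuclideanSpace ℝ (Fin n)) :
    Measurable fun t : ℝ => h (ν (ball x t) / ENNReal.ofReal t ^ (n - 1)) := by
  have : Monotone fun t : ℝ => ν (ball x t) := fun s t hst => measure_mono (ball_subset_ball hst)
  exact hh.measurable.comp (this.measurable.div (by fun_prop))

lemma wolffG_mono {n : ℕ} {h : ℝ≥0∞ → ℝ≥0∞} (hh : Monotone h)
    {ν ν' : Measure (EuclideanSpace ℝ (Fin n))} (hν : ν ≤ ν') (x : EuclideanSpace ℝ (Fin n)) :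
    wolffG n h ν x ≤ wolffG n h ν' x :=
  lintegral_mono fun t => hh (by gcongr)

lemma wolffG_withDensity_iSup {n : ℕ} {h : ℝ≥0∞ → ℝ≥0∞} (hh : Monotone h)
    (hsup : ∀ v : ℕ → ℝ≥0∞, h (⨆ k, v k) = ⨆ k, h (v k))
    (σ : Measure (EuclideanSpace ℝ (Fin n))) {φ : ℕ → EuclideanSpace ℝ (Fin n) → ℝ≥0∞}
    (hφ : ∀ k, Measurable (φ k)) (hmono : Monotone φ) (x : EuclideanSpace ℝ (Fin n)) :
    wolffG n h (σ.withDensity fun y => ⨆ k, φ k y) x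
      = ⨆ k, wolffG n h (σ.withDensity (φ k)) x := by
  unfold wolffG
  rw [← lintegral_iSup (fun k => measurable_wolffG_integrand hh _ x)]
  · refine lintegral_congr fun t => ?_
    rw [← hsup, ← ENNReal.iSup_div, withDensity_apply _ measurableSet_ball,
      lintegral_iSup hφ hmono]
    simp only [withDensity_apply _ measurableSet_ball]
  · intro k l hkl t
    exact hh (ENNReal.div_le_div_right
      (withDensity_mono (.of_forall (hmono hkl)) _) _)

lemma wolffG_withDensity_ffun_le {n : ℕ} {p q γ : ℝ} (hp : 1 < p) (hpq : p < q) (hγ0 : 0 < γ)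
    {h : ℝ≥0∞ → ℝ≥0∞} (hhg : ∀ s, gfun p q (h s) = s)
    {σ : Measure (EuclideanSpace ℝ (Fin n))} (hσfin : ∀ x r, σ (ball x r) < ⊤)
    {u : EuclideanSpace ℝ (Fin n) → ℝ≥0∞} (hu : Measurable u) (x : EuclideanSpace ℝ (Fin n)) :
    wolffG n h (σ.withDensity fun y => ffun p q γ (u y)) x ≤
      (ballMaximal σ (σ.withDensity fun y => u y ^ ((q - 1) * γ)) x ^ (1 / ((q - 1) * γ))) ^ γ *
        (wolffS n p σ x + wolffS n q σ x) := by
  have hh := monotone_of_gfun_inverse hp hpq hhg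
  set w := ballMaximal σ (σ.withDensity fun y => u y ^ ((q - 1) * γ)) x ^ (1 / ((q - 1) * γ))
    with hw
  have ha : 0 < (p - 1) * γ := mul_pos (by linarith) hγ0
  have hab : (p - 1) * γ ≤ (q - 1) * γ := by gcongr
  have hdens : ∀ t, σ.withDensity (fun y => ffun p q γ (u y)) (ball x t) ≤
      gfun p q (w ^ γ) * σ (ball x t) := by
    intro t
    rw [← ffun_eq_gfun, ffun, add_mul]
    refine le_trans (le_of_eq ?_) (add_le_add (withDensity_rpow_ball_le hσfin ha hab hu x t)
      (withDensity_rpow_ball_le hσfin (ha.trans_le hab) le_rfl hu x t))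
    simp only [withDensity_apply _ measurableSet_ball, ffun]
    exact lintegral_add_left (by fun_prop) _
  have hint (s : ℝ) (hs : 1 < s) : Measurable fun t : ℝ =>
      (σ (ball x t) / ENNReal.ofReal t ^ (n - 1)) ^ (1 / (s - 1)) :=
    measurable_wolffG_integrand (h := fun z => z ^ (1 / (s - 1)))
      (ENNReal.monotone_rpow_of_nonneg (one_div_nonneg.2 (by linarith))) σ x
  unfold wolffG wolffS
  rw [← lintegral_add_left (hint p hp), ← lintegral_const_mul _
    (by exact (hint p hp).add (hint q (hp.trans hpq)))]
  refine lintegral_mono fun t => ?_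
  refine le_trans (hh ?_) (gfun_inverse_mul_le hp hpq hhg _ _)
  rw [← mul_div_assoc]
  gcongr
  exact hdens t

/-- Energy estimate: the Wolff operator maps `L^r(σ)` to itself with multiplicative
constant `1 / 2`, up to an additive constant. -/
lemma exists_lintegral_wolffG_rpow_le {n : ℕ} {p q γ : ℝ} (hp : 1 < p) (hpq : p < q)
    (hγ0 : 0 < γ) (hγ1 : γ < 1) {h : ℝ≥0∞ → ℝ≥0∞} (hhg : ∀ s, gfun p q (h s) = s)
    {σ : Measure (EuclideanSpace ℝ (Fin n))} [SFinite σ] (hσfin : ∀ x r, σ (ball x r) < ⊤)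
    {r : ℝ} (hr1 : 1 < r) (hr : (q - 1) * γ < r)
    (hWp : ∫⁻ x, (wolffS n p σ x ^ (1 / (1 - γ))) ^ r ∂σ ≠ ⊤)
    (hWq : ∫⁻ x, (wolffS n q σ x ^ (1 / (1 - γ))) ^ r ∂σ ≠ ⊤) :
    ∃ K : ℝ≥0∞, K ≠ ⊤ ∧ ∀ u : EuclideanSpace ℝ (Fin n) → ℝ≥0∞, Measurable u →
      ∫⁻ x, wolffG n h (σ.withDensity fun y => ffun p q γ (u y)) x ^ r ∂σ ≤
        2⁻¹ * ∫⁻ x, u x ^ r ∂σ + K := by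
  have hb : 0 < (q - 1) * γ := mul_pos (by linarith) hγ0
  have hr0 : 0 < r := by linarith
  set θ := 1 / (1 - γ) with hθ
  have hθ1 : 1 ≤ θ := by
    rw [hθ, le_div_iff₀ (by linarith)]; linarith
  obtain ⟨C, hC, hmax⟩ := exists_lintegral_ballMaximal_rpow_le (EuclideanSpace ℝ (Fin n))
    (r := r / ((q - 1) * γ)) ((one_lt_div hb).2 hr)
  set ε : ℝ≥0∞ := (2 * (C + 1))⁻¹ with hε
  have hε0 : ε ≠ 0 := by simp [hε, hC, ENNReal.mul_eq_top]
  have hεtop : ε ≠ ⊤ := by simp [hε]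
  have hεC : ε * C ≤ 2⁻¹ := by
    rw [hε, ENNReal.mul_inv (by simp) (by simp), mul_assoc]
    refine mul_le_of_le_one_right' ?_
    rw [mul_comm, ← div_eq_mul_inv]
    exact ENNReal.div_le_of_le_mul (by simp)
  obtain ⟨K, hK, hyoung⟩ := exists_rpow_mul_rpow_le hγ0 hγ1 hε0 hεtop hr0
  have hrθ : 1 ≤ θ * r := by nlinarith
  have hWmeas (s : ℝ) (hs : 1 < s) : Measurable (wolffS n s σ) :=
    measurable_wolffG (h := fun z => z ^ (1 / (s - 1)))
      (ENNReal.monotone_rpow_of_nonneg (one_div_nonneg.2 (by linarith))) σ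
  have hWpm := hWmeas p hp
  have hWqm := hWmeas q (hp.trans hpq)
  refine ⟨K * (2 ^ (θ * r - 1) * (∫⁻ x, (wolffS n p σ x ^ θ) ^ r ∂σ +
    ∫⁻ x, (wolffS n q σ x ^ θ) ^ r ∂σ)), by finiteness, fun u hu => ?_⟩
  set w := fun x => ballMaximal σ (σ.withDensity fun y => u y ^ ((q - 1) * γ)) x ^
    (1 / ((q - 1) * γ)) with hw
  have hwm : Measurable w := (measurable_ballMaximal _ _).pow_const _
  have hwr : ∫⁻ x, w x ^ r ∂σ ≤ C * ∫⁻ x, u x ^ r ∂σ := by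
    have := hmax σ (fun y => u y ^ ((q - 1) * γ)) (by fun_prop)
    simpa only [hw, ← ENNReal.rpow_mul, mul_div_cancel₀ r hb.ne', one_div_mul_eq_div] using this
  have hpt : ∀ x, wolffG n h (σ.withDensity fun y => ffun p q γ (u y)) x ^ r ≤
      ε * w x ^ r + K * (2 ^ (θ * r - 1) *
        ((wolffS n p σ x ^ θ) ^ r + (wolffS n q σ x ^ θ) ^ r)) := by
    intro x
    calc _ ≤ (w x ^ γ * (wolffS n p σ x + wolffS n q σ x)) ^ r := by
          gcongr
          exact wolffG_withDensity_ffun_le hp hpq hγ0 hhg hσfin hu x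
      _ ≤ _ := hyoung _ _
      _ ≤ _ := by
          gcongr
          simp only [← ENNReal.rpow_mul]
          exact ENNReal.rpow_add_le_mul_rpow_add_rpow _ _ hrθ
  calc _ ≤ ∫⁻ x, ε * w x ^ r + K * (2 ^ (θ * r - 1) *
        ((wolffS n p σ x ^ θ) ^ r + (wolffS n q σ x ^ θ) ^ r)) ∂σ := lintegral_mono hpt
    _ = ε * ∫⁻ x, w x ^ r ∂σ + K * (2 ^ (θ * r - 1) * (∫⁻ x, (wolffS n p σ x ^ θ) ^ r ∂σ +
          ∫⁻ x, (wolffS n q σ x ^ θ) ^ r ∂σ)) := by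
        rw [lintegral_add_left (by fun_prop), lintegral_const_mul _ (by fun_prop),
          lintegral_const_mul _ (by fun_prop), lintegral_const_mul _ (by fun_prop),
          lintegral_add_left (by fun_prop)]
    _ ≤ _ := by
        refine add_le_add_left ?_ _
        calc _ ≤ ε * (C * ∫⁻ x, u x ^ r ∂σ) := mul_le_mul_right hwr _
          _ ≤ _ := by
            rw [← mul_assoc]
            exact mul_le_mul_left hεC _

lemma exists_gfun_mul_le_ffun_mul {p q γ : ℝ} (hp : 1 < p) (hpq : p < q) (hγ0 : 0 < γ)
    (hγ1 : γ < 1) {k c : ℝ≥0∞} (hk : k ≠ ⊤) (hc : c ≠ 0) :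
    ∃ ε : ℝ≥0∞, ε ≠ 0 ∧ ε ≠ ⊤ ∧ gfun p q (k * ε) ≤ ffun p q γ ε * c := by
  have key : ∀ {s : ℝ}, 0 < s → ∀ᶠ N : ℕ in Filter.atTop,
      (k * (N : ℝ≥0∞)⁻¹) ^ s ≤ ((N : ℝ≥0∞)⁻¹) ^ (s * γ) * c := by
    intro s hs
    have hs' : 0 < s * (1 - γ) := mul_pos hs (by linarith)
    have hlim : Filter.Tendsto (fun N : ℕ => k ^ s * ((N : ℝ≥0∞)⁻¹) ^ (s * (1 - γ)))
        Filter.atTop (nhds 0) := by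
      have h1 := (ENNReal.continuous_rpow_const (y := s * (1 - γ))).tendsto 0 |>.comp
        ENNReal.tendsto_inv_nat_nhds_zero
      have h2 := ENNReal.Tendsto.const_mul h1 (Or.inr (by finiteness : k ^ s ≠ ⊤))
      simpa [ENNReal.zero_rpow_of_pos hs'] using h2
    filter_upwards [hlim.eventually_le_const (pos_iff_ne_zero.2 hc)] with N hN
    calc (k * (N : ℝ≥0∞)⁻¹) ^ s
        = ((N : ℝ≥0∞)⁻¹) ^ (s * γ) * (k ^ s * ((N : ℝ≥0∞)⁻¹) ^ (s * (1 - γ))) := by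
          rw [ENNReal.mul_rpow_of_nonneg _ _ hs.le, mul_left_comm,
            ← ENNReal.rpow_add_of_nonneg _ _ (by positivity) hs'.le]
          ring_nf
      _ ≤ _ := by gcongr
  obtain ⟨N, h1, h2, h3⟩ := ((key (s := p - 1) (by linarith)).and
    ((key (s := q - 1) (by linarith)).and (Filter.eventually_ge_atTop 1))).exists
  refine ⟨(N : ℝ≥0∞)⁻¹, by simp, by simp; omega, ?_⟩
  rw [gfun, ffun, add_mul]
  exact add_le_add h1 h2

/-- A small multiple of the indicator of a ball is a subsolution. -/
lemma exists_indicator_ball_le_wolffG {n : ℕ} {p q γ : ℝ} (hp : 1 < p) (hpq : p < q)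
    (hγ0 : 0 < γ) (hγ1 : γ < 1) {h : ℝ≥0∞ → ℝ≥0∞} (hhg : ∀ s, gfun p q (h s) = s)
    (σ : Measure (EuclideanSpace ℝ (Fin n))) (z : EuclideanSpace ℝ (Fin n)) {R : ℝ}
    (hR : 0 < R) (hσ0 : σ (ball z R) ≠ 0) :
    ∃ ε : ℝ≥0∞, ε ≠ 0 ∧ ε ≠ ⊤ ∧ ∀ x, (ball z R).indicator (fun _ => ε) x ≤
      wolffG n h (σ.withDensity fun y =>
        ffun p q γ ((ball z R).indicator (fun _ => ε) y)) x := by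
  have hR2 : ENNReal.ofReal (2 * R) ≠ 0 := by simpa using hR
  set c := σ (ball z R) / ENNReal.ofReal (4 * R) ^ (n - 1) with hcdef
  have hc : c ≠ 0 := ENNReal.div_ne_zero.2 ⟨hσ0, by finiteness⟩
  obtain ⟨ε, hε0, hεtop, hε⟩ := exists_gfun_mul_le_ffun_mul hp hpq hγ0 hγ1
    (ENNReal.inv_ne_top.2 hR2) hc
  refine ⟨ε, hε0, hεtop, fun x => ?_⟩
  by_cases hx : x ∈ ball z R
  swap
  · simp [hx]
  rw [indicator_of_mem hx]
  have hmass : ∀ t, 2 * R ≤ t → ffun p q γ ε * σ (ball z R) ≤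
      σ.withDensity (fun y => ffun p q γ ((ball z R).indicator (fun _ => ε) y)) (ball x t) := by
    intro t ht
    have hsub : ball z R ⊆ ball x t := by
      refine ball_subset_ball' ?_
      rw [mem_ball, dist_comm] at hx
      linarith
    calc ffun p q γ ε * σ (ball z R)
        = ∫⁻ y in ball z R, ffun p q γ ((ball z R).indicator (fun _ => ε) y) ∂σ := by
          rw [← setLIntegral_const]
          exact setLIntegral_congr_fun measurableSet_ball fun y hy => by
            simp only [indicator_of_mem hy]
      _ = σ.withDensity (fun y => ffun p q γ ((ball z R).indicator (fun _ => ε) y))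
            (ball z R) := (withDensity_apply _ measurableSet_ball).symm
      _ ≤ _ := measure_mono hsub
  calc ε = ∫⁻ t in Ioo (2 * R) (4 * R), (ENNReal.ofReal (2 * R))⁻¹ * ε := by
        rw [setLIntegral_const, Real.volume_Ioo, show 4 * R - 2 * R = 2 * R by ring, mul_right_comm,
          ENNReal.inv_mul_cancel hR2 ENNReal.ofReal_ne_top, one_mul]
    _ ≤ ∫⁻ t in Ioo (2 * R) (4 * R), h (σ.withDensity (fun y => ffun p q γ
          ((ball z R).indicator (fun _ => ε) y)) (ball x t) / ENNReal.ofReal t ^ (n - 1)) := by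
        refine setLIntegral_mono' measurableSet_Ioo fun t ht => ?_
        rw [le_gfun_inverse_iff hp hpq hhg]
        refine hε.trans ?_
        rw [hcdef, ← mul_div_assoc]
        gcongr
        · exact hmass t ht.1.le
        · exact ht.2.le
    _ ≤ _ := by
        refine lintegral_mono_set fun t ht => ?_
        exact lt_trans (by linarith : (0 : ℝ) < 2 * R) ht.1

lemma lintegral_Ffun_lt_top_iff {α : Type*} [MeasurableSpace α] {μ : Measure α} {p q γ : ℝ}
    (hp : 1 < p) (hq : 1 < q) (hγ : 0 < γ) {v : α → ℝ≥0∞} (hv : Measurable v) :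
    ∫⁻ x, Ffun p q γ (v x) ∂μ < ⊤ ↔
      ∫⁻ x, v x ^ ((p - 1) * γ + 1) ∂μ ≠ ⊤ ∧ ∫⁻ x, v x ^ ((q - 1) * γ + 1) ∂μ ≠ ⊤ := by
  have key : ∀ {s : ℝ}, 1 < s → ∀ z : ℝ≥0∞,
      z * (ENNReal.ofReal ((s - 1) * γ + 1))⁻¹ = ⊤ ↔ z = ⊤ := by
    intro s hs z
    have : 0 < (s - 1) * γ := mul_pos (by linarith) hγ
    have h1 : (ENNReal.ofReal ((s - 1) * γ + 1))⁻¹ ≠ ⊤ := by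
      simpa using (by linarith : 0 < (s - 1) * γ + 1)
    simp [ENNReal.mul_eq_top, h1]
  simp only [Ffun, div_eq_mul_inv]
  rw [lintegral_add_left (by fun_prop), lintegral_mul_const _ (by fun_prop),
    lintegral_mul_const _ (by fun_prop), ENNReal.add_lt_top, lt_top_iff_ne_top,
    lt_top_iff_ne_top, Ne, Ne, key hp, key hq]

/-- Theorem (existence of a nontrivial finite-energy solution to the Wolff integral
equation `u = W_G((f∘u)dσ)` under condition (A)). -/
theorem existence_wolff_equation
    (n : ℕ) (hn : 3 ≤ n) (p q γ : ℝ) (hp : 1 < p) (hpq : p < q)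
    (hγ0 : 0 < γ) (hγ : γ < min ((p - 1) / (q - 1)) (1 / (q - p)))
    (h : ℝ≥0∞ → ℝ≥0∞)
    (hgh : ∀ t, h (gfun p q t) = t) (hhg : ∀ s, gfun p q (h s) = s)
    (σ : Measure (EuclideanSpace ℝ (Fin n)))
    (hσfin : ∀ (x : EuclideanSpace ℝ (Fin n)) (r : ℝ), σ (ball x r) < ⊤)
    (hσne : σ ≠ 0)
    (hA : condA n p q γ σ) :
    ∃ u : EuclideanSpace ℝ (Fin n) → ℝ≥0∞, Measurable u ∧
      0 < σ {x | 0 < u x} ∧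
      (∫⁻ x, Ffun p q γ (u x) ∂σ) < ⊤ ∧
      ∀ x, u x = wolffG n h (σ.withDensity fun y => ffun p q γ (u y)) x := by
  have hγ1 : γ < 1 := (hγ.trans_le (min_le_left _ _)).trans
    ((div_lt_one (by linarith)).2 (by linarith))
  have hγqp : (q - 1) * γ < (p - 1) * γ + 1 := by
    have := (lt_div_iff₀ (by linarith)).1 (hγ.trans_le (min_le_right _ _))
    linarith
  have hq : 1 < q := hp.trans hpq
  have hpγ : 0 < (p - 1) * γ := mul_pos (by linarith) hγ0
  have hqγ : 0 < (q - 1) * γ := mul_pos (by linarith) hγ0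
  have : IsLocallyFiniteMeasure σ := ⟨fun x => ⟨ball x 1, ball_mem_nhds x one_pos, hσfin x 1⟩⟩
  have hh := monotone_of_gfun_inverse hp hpq hhg
  have hWmeas (s : ℝ) (hs : 1 < s) : Measurable (wolffS n s σ) :=
    measurable_wolffG (h := fun z => z ^ (1 / (s - 1)))
      (ENNReal.monotone_rpow_of_nonneg (one_div_nonneg.2 (by linarith))) σ
  have hWp := (lintegral_Ffun_lt_top_iff hp hq hγ0 ((hWmeas p hp).pow_const _)).1
    (hA p (by simp) (1 / (1 - γ)) (by simp))
  have hWq := (lintegral_Ffun_lt_top_iff hp hq hγ0 ((hWmeas q hq).pow_const _)).1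
    (hA q (by simp) (1 / (1 - γ)) (by simp))
  obtain ⟨R, hR0, hR⟩ : ∃ R : ℝ, 0 < R ∧ σ (ball 0 R) ≠ 0 := by
    by_contra! hcon
    refine hσne (Measure.measure_univ_eq_zero.1 ?_)
    rw [← iUnion_ball_nat_succ (0 : EuclideanSpace ℝ (Fin n)), measure_iUnion_null_iff]
    exact fun k => hcon _ (by positivity)
  obtain ⟨ε, hε0, hεtop, hsub⟩ := exists_indicator_ball_le_wolffG hp hpq hγ0 hγ1 hhg σ 0 hR0 hR
  let T (u : EuclideanSpace ℝ (Fin n) → ℝ≥0∞) : EuclideanSpace ℝ (Fin n) → ℝ≥0∞ :=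
    wolffG n h (σ.withDensity fun y => ffun p q γ (u y))
  let u₀ : EuclideanSpace ℝ (Fin n) → ℝ≥0∞ := (ball 0 R).indicator fun _ => ε
  let u (k : ℕ) : EuclideanSpace ℝ (Fin n) → ℝ≥0∞ := T^[k] u₀
  have husucc (k : ℕ) : u (k + 1) = T (u k) := Function.iterate_succ_apply' T k u₀
  have hTmono : Monotone T := fun v w hvw x => wolffG_mono hh
    (withDensity_mono (.of_forall fun y => monotone_ffun hp hpq hγ0 (hvw y))) x
  have humono : Monotone u := hTmono.monotone_iterate_of_le_map hsub
  have humeas (k : ℕ) : Measurable (u k) := by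
    cases k with
    | zero => exact measurable_const.indicator measurableSet_ball
    | succ k => exact husucc k ▸ measurable_wolffG hh _
  have hbound {r : ℝ} (hr1 : 1 < r) (hr : (q - 1) * γ < r)
      (hWp : ∫⁻ x, (wolffS n p σ x ^ (1 / (1 - γ))) ^ r ∂σ ≠ ⊤)
      (hWq : ∫⁻ x, (wolffS n q σ x ^ (1 / (1 - γ))) ^ r ∂σ ≠ ⊤) :
      ∫⁻ x, (⨆ k, u k x) ^ r ∂σ ≠ ⊤ := by
    have hr0 : 0 < r := by linarith
    obtain ⟨K, hK, hstep⟩ :=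
      exists_lintegral_wolffG_rpow_le hp hpq hγ0 hγ1 hhg hσfin hr1 hr hWp hWq
    have h0 : ∫⁻ x, u 0 x ^ r ∂σ ≠ ⊤ := by
      have hu0 (x) : u 0 x ^ r = (ball 0 R).indicator (fun _ => ε ^ r) x := by
        change (ball 0 R).indicator (fun _ => ε) x ^ r = _
        by_cases hx : x ∈ ball 0 R
        · rw [indicator_of_mem hx, indicator_of_mem hx]
        · rw [indicator_of_notMem hx, indicator_of_notMem hx, ENNReal.zero_rpow_of_pos hr0]
      rw [lintegral_congr hu0]
      rw [lintegral_indicator_const measurableSet_ball]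
      have := (hσfin 0 R).ne
      finiteness
    have hall (k : ℕ) : ∫⁻ x, u k x ^ r ∂σ ≤ ∫⁻ x, u 0 x ^ r ∂σ + 2 * K := by
      induction k with
      | zero => exact le_self_add
      | succ k ih =>
        rw [husucc]
        calc _ ≤ 2⁻¹ * ∫⁻ x, u k x ^ r ∂σ + K := hstep _ (humeas k)
          _ ≤ 2⁻¹ * (∫⁻ x, u 0 x ^ r ∂σ + 2 * K) + K := by gcongr
          _ = 2⁻¹ * ∫⁻ x, u 0 x ^ r ∂σ + 2 * K := by
            rw [mul_add, ← mul_assoc, ENNReal.inv_mul_cancel (by simp) (by simp)]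
            ring
          _ ≤ _ := by
            gcongr
            exact mul_le_of_le_one_left' (by simp)
    have hpow (x) : (⨆ k, u k x) ^ r = ⨆ k, u k x ^ r :=
      (ENNReal.orderIsoRpow r hr0).map_iSup _
    rw [lintegral_congr hpow]
    rw [lintegral_iSup (fun k => (humeas k).pow_const r)
      fun k l hkl x => ENNReal.rpow_le_rpow (humono hkl x) hr0.le]
    exact ne_top_of_le_ne_top (by finiteness) (iSup_le hall)
  have hUmeas : Measurable fun x => ⨆ k, u k x := .iSup humeas
  refine ⟨fun x => ⨆ k, u k x, hUmeas, ?_, ?_, fun x => ?_⟩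
  · refine (pos_iff_ne_zero.2 hR).trans_le (measure_mono fun x hx => ?_)
    refine (pos_iff_ne_zero.2 hε0).trans_le (le_trans (le_of_eq ?_) (le_iSup (u · x) 0))
    exact (indicator_of_mem hx fun _ => ε).symm
  · rw [lintegral_Ffun_lt_top_iff hp hq hγ0 hUmeas]
    exact ⟨hbound (by linarith) hγqp hWp.1 hWq.1,
      hbound (by linarith) (by linarith) hWp.2 hWq.2⟩
  · simp_rw [ffun_iSup hp hpq hγ0 hhg]
    rw [wolffG_withDensity_iSup (φ := fun k y => ffun p q γ (u k y)) hh
      (map_iSup_of_gfun_inverse hp hpq hhg) σ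
      (fun k => (measurable_ffun p q γ).comp (humeas k))
      fun k l hkl y => monotone_ffun hp hpq hγ0 (humono hkl y)]
    rw [← (show Monotone (u · x) from fun k l hkl => humono hkl x).iSup_nat_add 1]
    simp_rw [husucc]
    rfl
end

section
/- Let n ≥ 3 and let σ be a nonnegative Borel measure on ℝⁿ, finite on bounded sets, satisfying condition (A). Then there exists a constant c > 0 such that for every Borel function u : ℝⁿ → [0,∞] with A := ∫_{ℝⁿ} F(u) dσ < ∞, one has ∫_{ℝⁿ} F( W_G((f∘u)·dσ) ) dσ ≤ c · ( A^(γ(p−1)/(q−1)) + A^γ + A^(γ(q−1)/(p−1)) ). -/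
open MeasureTheory Metric Set
open scoped ENNReal

theorem ENNReal.add_rpow_le_two_rpow_mul (x y : ℝ≥0∞) {c : ℝ} (hc : 0 ≤ c) :
    (x + y) ^ c ≤ 2 ^ c * (x ^ c + y ^ c) := by
  wlog hxy : x ≤ y generalizing x y
  · rw [add_comm x y, add_comm (x ^ c)]
    exact this y x (le_of_not_ge hxy)
  calc (x + y) ^ c ≤ (2 * y) ^ c := by
        apply ENNReal.rpow_le_rpow _ hc
        rw [two_mul]; gcongr
    _ = 2 ^ c * y ^ c := ENNReal.mul_rpow_of_nonneg _ _ hc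
    _ ≤ _ := by gcongr; exact le_add_self

/-- Layer-cake representation of a power of a constant. -/
theorem lintegral_indicator_rpow_sub_one {e : ℝ} (he : 0 < e) (y : ℝ≥0∞) :
    ENNReal.ofReal e * ∫⁻ l in Ioi (0 : ℝ),
      {l : ℝ | ENNReal.ofReal l < y}.indicator (fun l => ENNReal.ofReal (l ^ (e - 1))) l
        = y ^ e := by
  have key : ∀ z : ℝ, 0 ≤ z → ENNReal.ofReal e * ∫⁻ l in Ioi (0 : ℝ),
      {l : ℝ | ENNReal.ofReal l < ENNReal.ofReal z}.indicator
        (fun l => ENNReal.ofReal (l ^ (e - 1))) l = (ENNReal.ofReal z) ^ e := by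
    intro z hz
    have h := lintegral_rpow_eq_lintegral_meas_lt_mul (μ := Measure.dirac ()) (f := fun _ => z)
      (Filter.Eventually.of_forall fun _ => hz) aemeasurable_const he
    rw [lintegral_const, measure_univ, mul_one] at h
    rw [ENNReal.ofReal_rpow_of_nonneg hz he.le, h]
    congr 1
    refine setLIntegral_congr_fun measurableSet_Ioi fun l hl => ?_
    simp only [indicator, mem_ofPred_eq, ENNReal.ofReal_lt_ofReal_iff_of_nonneg (le_of_lt hl)]
    split_ifs with hlz <;> simp [hlz]
  rcases eq_or_ne y ⊤ with rfl | hy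
  · rw [ENNReal.top_rpow_of_pos he, eq_top_iff]
    refine ENNReal.le_of_forall_nnreal_lt fun r _ => ?_
    have h := key ((r : ℝ) ^ e⁻¹) (by positivity)
    rw [ENNReal.ofReal_rpow_of_nonneg (by positivity) he.le, Real.rpow_inv_rpow r.coe_nonneg he.ne',
      ENNReal.ofReal_coe_nnreal] at h
    rw [← h]
    gcongr with l
    exact le_top
  · rw [← ENNReal.ofReal_toReal hy]
    exact key _ ENNReal.toReal_nonneg

section Maximal

variable {X : Type*} [MetricSpace X] [MeasurableSpace X] [BorelSpace X]

/-- Weak type inequality from the Besicovitch covering theorem. -/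
theorem exists_weak_type_bound (X : Type*) [MetricSpace X] [SecondCountableTopology X]
    [MeasurableSpace X] [BorelSpace X] [HasBesicovitchCovering X] :
    ∃ N : ℕ, ∀ (σ μ : Measure X) (l : ℝ≥0∞),
      l * σ {x | ∃ r : ℝ, 0 < r ∧ l * σ (ball x r) < μ (ball x r)} ≤ N * μ univ := by
  obtain ⟨N, τ, hτ, hN⟩ := HasBesicovitchCovering.no_satelliteConfig (α := X)
  refine ⟨N, fun σ μ l => ?_⟩
  set E : ℕ → Set X := fun k => {x | ∃ r : ℝ, 0 < r ∧ r ≤ k ∧ l * σ (ball x r) < μ (ball x r)}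
    with hE
  have hEm : Monotone E := by
    rintro i j hij x ⟨r, h0, hr, h⟩
    exact ⟨r, h0, hr.trans (by exact_mod_cast hij), h⟩
  have hEU : {x | ∃ r : ℝ, 0 < r ∧ l * σ (ball x r) < μ (ball x r)} = ⋃ k, E k := by
    ext x
    simp only [mem_ofPred_eq, mem_iUnion, hE]
    constructor
    · rintro ⟨r, h0, h⟩
      obtain ⟨k, hk⟩ := exists_nat_ge r
      exact ⟨k, r, h0, hk, h⟩
    · rintro ⟨k, r, h0, -, h⟩
      exact ⟨r, h0, h⟩
  rw [hEU, hEm.measure_iUnion, ENNReal.mul_iSup]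
  refine iSup_le fun k => ?_
  choose r hr0 hrk hr using fun x : E k => x.2
  let B : Besicovitch.BallPackage (E k) X := ⟨fun x => x, r, hr0, k, hrk⟩
  obtain ⟨s, hs, hcov⟩ := Besicovitch.exist_disjoint_covering_families hτ hN B
  have hd : ∀ i, (s i).PairwiseDisjoint fun j => ball (j : X) (r j) := fun i =>
    (hs i).mono fun j => ball_subset_closedBall
  have hc : ∀ i, (s i).Countable := fun i =>
    (hd i).countable_of_isOpen (fun _ _ => isOpen_ball) fun j _ => ⟨j, mem_ball_self (hr0 j)⟩
  have hcov' : E k ⊆ ⋃ i : Fin N, ⋃ j ∈ s i, ball (j : X) (r j) := by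
    intro x hx
    exact hcov ⟨⟨x, hx⟩, rfl⟩
  calc l * σ (E k) ≤ l * σ (⋃ i : Fin N, ⋃ j ∈ s i, ball (j : X) (r j)) := by gcongr
    _ ≤ l * ∑ i : Fin N, ∑' j : s i, σ (ball (j : X) (r j)) := by
        gcongr
        refine (measure_iUnion_fintype_le _ _).trans ?_
        gcongr with i
        exact measure_biUnion_le _ (hc i) _
    _ = ∑ i : Fin N, ∑' j : s i, l * σ (ball (j : X) (r j)) := by
        simp_rw [Finset.mul_sum, ENNReal.tsum_mul_left]
    _ ≤ ∑ i : Fin N, ∑' j : s i, μ (ball (j : X) (r j)) := by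
        gcongr with i _ j
        exact (hr j).le
    _ = ∑ i : Fin N, μ (⋃ j ∈ s i, ball (j : X) (r j)) := by
        congr! with i
        rw [measure_biUnion (hc i) (hd i) fun _ _ => measurableSet_ball]
    _ ≤ ∑ i : Fin N, μ univ := by gcongr; exact subset_univ _
    _ = N * μ univ := by simp

/-- The centered maximal function with respect to `σ`, taken over rational radii. -/
noncomputable def centeredMaximal (σ : Measure X) (v : X → ℝ≥0∞) (x : X) : ℝ≥0∞ :=
  ⨆ r : {r : ℚ // 0 < r}, (∫⁻ y in ball x r, v y ∂σ) / σ (ball x r)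

theorem measurable_measure_ball_prod [SecondCountableTopology X] (μ : Measure X) [SFinite μ] :
    Measurable fun z : X × ℝ => μ (ball z.1 z.2) := by
  have hs : MeasurableSet {z : (X × ℝ) × X | dist z.2 z.1.1 < z.1.2} :=
    (isOpen_lt (by fun_prop) (by fun_prop)).measurableSet
  exact measurable_measure_prodMk_left hs

theorem measurable_measure_ball_s5 [SecondCountableTopology X] (μ : Measure X) [SFinite μ] (r : ℝ) :
    Measurable fun x => μ (ball x r) :=
  (measurable_measure_ball_prod μ).comp (measurable_id.prodMk measurable_const)

theorem measurable_centeredMaximal [SecondCountableTopology X] (σ : Measure X) [SFinite σ]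
    (v : X → ℝ≥0∞) :
    Measurable (centeredMaximal σ v) := by
  refine Measurable.iSup fun r => ?_
  refine Measurable.div ?_ (measurable_measure_ball_s5 σ _)
  simp_rw [← withDensity_apply v measurableSet_ball]
  exact measurable_measure_ball_s5 _ _

theorem setLIntegral_ball_le_centeredMaximal_mul (σ : Measure X)
    (hσ : ∀ x r, σ (ball x r) < ⊤) (v : X → ℝ≥0∞) (x : X) (t : ℝ) :
    ∫⁻ y in ball x t, v y ∂σ ≤ centeredMaximal σ v x * σ (ball x t) := by
  have hrat : ∀ r : ℚ, (∫⁻ y in ball x r, v y ∂σ) ≤ centeredMaximal σ v x * σ (ball x r) := by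
    intro r
    rcases le_or_gt r 0 with hr | hr
    · rw [ball_eq_empty.2 (by exact_mod_cast hr)]; simp
    rcases eq_or_ne (σ (ball x r)) 0 with h0 | h0
    · rw [setLIntegral_measure_zero _ _ h0]; exact zero_le
    rw [← ENNReal.div_le_iff h0 (hσ _ _).ne]
    exact le_iSup (fun r : {r : ℚ // 0 < r} => (∫⁻ y in ball x r, v y ∂σ) / σ (ball x r)) ⟨r, hr⟩
  have hU : ball x t = ⋃ r : {r : ℚ // (r : ℝ) < t}, ball x r := by
    ext y
    simp only [mem_ball, mem_iUnion]
    constructor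
    · intro h
      obtain ⟨r, hr1, hr2⟩ := exists_rat_btwn h
      exact ⟨⟨r, hr2⟩, hr1⟩
    · rintro ⟨r, hr⟩
      exact hr.trans r.2
  have hm : Monotone fun r : {r : ℚ // (r : ℝ) < t} => ball x (r : ℝ) := by
    intro r s hrs
    exact ball_subset_ball (by exact_mod_cast hrs)
  rw [← withDensity_apply v measurableSet_ball]
  nth_rewrite 1 [hU]
  rw [hm.measure_iUnion]
  refine iSup_le fun r => ?_
  rw [withDensity_apply v measurableSet_ball]
  refine (hrat r).trans ?_
  gcongr
  exact r.2.le

theorem centeredMaximal_weak_type {N : ℕ} {σ : Measure X}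
    (hN : ∀ (μ : Measure X) (l : ℝ≥0∞),
      l * σ {x | ∃ r : ℝ, 0 < r ∧ l * σ (ball x r) < μ (ball x r)} ≤ N * μ univ)
    {v : X → ℝ≥0∞} (hv : Measurable v) (l : ℝ≥0∞) :
    l * σ {x | l < centeredMaximal σ v x} ≤ 2 * N * ∫⁻ y, {y | l < 2 * v y}.indicator v y ∂σ := by
  have hms : MeasurableSet {y | l < 2 * v y} := measurableSet_lt measurable_const (hv.const_mul 2)
  have hsub : {x | l < centeredMaximal σ v x} ⊆ {x | ∃ r : ℝ, 0 < r ∧ l / 2 * σ (ball x r) <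
      σ.withDensity ({y | l < 2 * v y}.indicator v) (ball x r)} := by
    intro x hx
    obtain ⟨r, hr⟩ := lt_iSup_iff.1 (show l < centeredMaximal σ v x from hx)
    refine ⟨r, by exact_mod_cast r.2, ?_⟩
    rw [withDensity_apply _ measurableSet_ball]
    by_contra! hcon
    refine (ENNReal.mul_lt_of_lt_div hr).not_ge ?_
    calc ∫⁻ y in ball x r, v y ∂σ
        ≤ ∫⁻ y in ball x r, ({y | l < 2 * v y}.indicator v y + l / 2) ∂σ := by
          gcongr with y
          by_cases hy : l < 2 * v y
          · rw [indicator_of_mem (by exact hy)]; exact le_self_add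
          · refine le_add_left ?_
            rw [ENNReal.le_div_iff_mul_le (by simp) (by simp), mul_comm]
            exact not_lt.1 hy
      _ = (∫⁻ y in ball x r, {y | l < 2 * v y}.indicator v y ∂σ) + l / 2 * σ (ball x r) := by
          rw [lintegral_add_right _ measurable_const, setLIntegral_const]
      _ ≤ l / 2 * σ (ball x r) + l / 2 * σ (ball x r) := by gcongr
      _ = l * σ (ball x r) := by rw [← add_mul, ENNReal.add_halves]
  calc l * σ {x | l < centeredMaximal σ v x}
      = 2 * (l / 2 * σ {x | l < centeredMaximal σ v x}) := by
        rw [← mul_assoc, ENNReal.mul_div_cancel (by simp) (by simp)]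
    _ ≤ 2 * (N * (σ.withDensity ({y | l < 2 * v y}.indicator v)) univ) := by
        gcongr 2 * ?_
        refine le_trans ?_ (hN _ (l / 2))
        gcongr
    _ = _ := by rw [withDensity_apply _ MeasurableSet.univ, Measure.restrict_univ, mul_assoc]

/-- Strong type inequality for the centered maximal function. -/
theorem exists_lintegral_centeredMaximal_rpow_le [SecondCountableTopology X]
    [HasBesicovitchCovering X] (σ : Measure X) [SFinite σ] {s : ℝ} (hs : 1 < s) :
    ∃ C : ℝ≥0∞, C ≠ ⊤ ∧ ∀ v : X → ℝ≥0∞, Measurable v →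
      ∫⁻ x, centeredMaximal σ v x ^ s ∂σ ≤ C * ∫⁻ x, v x ^ s ∂σ := by
  obtain ⟨N, hN⟩ := exists_weak_type_bound X
  refine ⟨ENNReal.ofReal s * (2 * N) * ((ENNReal.ofReal (s - 1))⁻¹ * 2 ^ (s - 1)), ?_,
    fun v hv => ?_⟩
  · have h1 : (ENNReal.ofReal (s - 1))⁻¹ ≠ ⊤ := by simpa using hs
    have h2 : (2 : ℝ≥0∞) ^ (s - 1) ≠ ⊤ :=
      ENNReal.rpow_ne_top_of_nonneg (by linarith) (by simp)
    finiteness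
  have hM := measurable_centeredMaximal σ v
  have hjoint : ∀ w : X → ℝ≥0∞, Measurable w → ∀ e : ℝ, Measurable fun z : X × ℝ =>
      {l : ℝ | ENNReal.ofReal l < w z.1}.indicator (fun l => ENNReal.ofReal (l ^ e)) z.2 := by
    intro w hw e
    have hset : MeasurableSet {z : X × ℝ | ENNReal.ofReal z.2 < w z.1} :=
      measurableSet_lt (by fun_prop) (by fun_prop)
    exact Measurable.indicator (f := fun z : X × ℝ => ENNReal.ofReal (z.2 ^ e)) (by fun_prop) hset
  have hs1 : 0 < s - 1 := by linarith
  calc ∫⁻ x, centeredMaximal σ v x ^ s ∂σ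
      = ∫⁻ x, ENNReal.ofReal s * (∫⁻ l in Ioi (0 : ℝ),
        {l : ℝ | ENNReal.ofReal l < centeredMaximal σ v x}.indicator
          (fun l => ENNReal.ofReal (l ^ (s - 1))) l) ∂σ := by
        simp_rw [lintegral_indicator_rpow_sub_one (show 0 < s by linarith)]
    _ = ENNReal.ofReal s * ∫⁻ l in Ioi (0 : ℝ), ∫⁻ x,
        {l : ℝ | ENNReal.ofReal l < centeredMaximal σ v x}.indicator
          (fun l => ENNReal.ofReal (l ^ (s - 1))) l ∂σ := by
        rw [lintegral_const_mul' _ _ ENNReal.ofReal_ne_top, lintegral_lintegral_swap]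
        exact (hjoint _ hM _).aemeasurable
    _ ≤ ENNReal.ofReal s * ∫⁻ l in Ioi (0 : ℝ), 2 * N * ∫⁻ y,
        v y * {l : ℝ | ENNReal.ofReal l < 2 * v y}.indicator
          (fun l => ENNReal.ofReal (l ^ (s - 1 - 1))) l ∂σ := by
        gcongr ENNReal.ofReal s * ?_
        refine setLIntegral_mono' measurableSet_Ioi fun l hl => ?_
        have hl : 0 < l := hl
        calc ∫⁻ x, {l : ℝ | ENNReal.ofReal l < centeredMaximal σ v x}.indicator
              (fun l => ENNReal.ofReal (l ^ (s - 1))) l ∂σ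
            = ENNReal.ofReal (l ^ (s - 1)) *
              σ {x | ENNReal.ofReal l < centeredMaximal σ v x} := by
              rw [← lintegral_indicator_const (measurableSet_lt measurable_const hM)]
              rfl
          _ = ENNReal.ofReal (l ^ (s - 1 - 1)) * (ENNReal.ofReal l *
              σ {x | ENNReal.ofReal l < centeredMaximal σ v x}) := by
              rw [← mul_assoc, ← ENNReal.ofReal_mul (by positivity),
                Real.rpow_sub_one hl.ne' (s - 1), div_mul_cancel₀ _ hl.ne']
          _ ≤ ENNReal.ofReal (l ^ (s - 1 - 1)) *
              (2 * N * ∫⁻ y, {y | ENNReal.ofReal l < 2 * v y}.indicator v y ∂σ) := by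
              gcongr ENNReal.ofReal (l ^ (s - 1 - 1)) * ?_
              exact centeredMaximal_weak_type (hN σ) hv _
          _ = _ := by
              rw [mul_left_comm, ← lintegral_const_mul' _ _ ENNReal.ofReal_ne_top]
              congr 2 with y
              simp only [indicator, mem_ofPred_eq]
              split_ifs <;> simp [mul_comm]
    _ = ENNReal.ofReal s * (2 * N) * ∫⁻ y, v y * (∫⁻ l in Ioi (0 : ℝ),
        {l : ℝ | ENNReal.ofReal l < 2 * v y}.indicator
          (fun l => ENNReal.ofReal (l ^ (s - 1 - 1))) l) ∂σ := by
        have hj := hjoint (fun y => 2 * v y) (hv.const_mul 2) (s - 1 - 1)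
        rw [lintegral_const_mul' _ _ (by finiteness), ← mul_assoc, lintegral_lintegral_swap]
        · congr 2 with y
          rw [lintegral_const_mul]
          exact hj.comp measurable_prodMk_left
        · exact (((hv.comp measurable_fst).mul hj).comp measurable_swap).aemeasurable
    _ = ENNReal.ofReal s * (2 * N) * ∫⁻ y, (ENNReal.ofReal (s - 1))⁻¹ * 2 ^ (s - 1) *
        v y ^ s ∂σ := by
        congr 2 with y
        have h0 : ENNReal.ofReal (s - 1) ≠ 0 := by simpa using hs
        have hpow : v y ^ s = v y * v y ^ (s - 1) := by
          conv_lhs => rw [← add_sub_cancel 1 s,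
            ENNReal.rpow_add_of_nonneg _ _ zero_le_one hs1.le, ENNReal.rpow_one]
        rw [hpow, mul_left_comm, mul_assoc, ← ENNReal.mul_rpow_of_nonneg _ _ hs1.le,
          ← lintegral_indicator_rpow_sub_one hs1 (2 * v y),
          ENNReal.inv_mul_cancel_left h0 ENNReal.ofReal_ne_top]
    _ = _ := by
        rw [lintegral_const_mul _ (hv.pow_const s), ← mul_assoc]

end Maximal

theorem measurable_wolffS (n : ℕ) (s : ℝ) (σ : Measure (EuclideanSpace ℝ (Fin n))) [SFinite σ] :
    Measurable (wolffS n s σ) := by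
  have hm : Measurable fun z : EuclideanSpace ℝ (Fin n) × ℝ =>
      (σ (ball z.1 z.2) / ENNReal.ofReal z.2 ^ (n - 1)) ^ (1 / (s - 1)) :=
    ((measurable_measure_ball_prod σ).div (by fun_prop)).pow_const _
  exact hm.lintegral_prod_right'

/-- An upper bound for the inverse of `g`. -/
theorem le_rpow_of_gfun_eq {p q : ℝ} (hp : 1 < p) {h : ℝ≥0∞ → ℝ≥0∞}
    (hhg : ∀ s, gfun p q (h s) = s) (s : ℝ≥0∞) : h s ≤ s ^ (1 / (p - 1)) := by
  rw [one_div, ENNReal.le_rpow_inv_iff (by linarith)]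
  exact le_self_add.trans_eq (hhg s)

/-- Pointwise bound of the potential of `f(u)dσ` by maximal functions and a Wolff potential. -/
theorem wolffG_withDensity_le {n : ℕ} {p q γ : ℝ} (hp : 1 < p) {h : ℝ≥0∞ → ℝ≥0∞}
    (hhg : ∀ s, gfun p q (h s) = s) {σ : Measure (EuclideanSpace ℝ (Fin n))} [SFinite σ]
    (hσ : ∀ x r, σ (ball x r) < ⊤) {u : EuclideanSpace ℝ (Fin n) → ℝ≥0∞} (hu : Measurable u)
    (x : EuclideanSpace ℝ (Fin n)) :
    wolffG n h (σ.withDensity fun y => ffun p q γ (u y)) x ≤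
      (centeredMaximal σ (fun y => u y ^ ((p - 1) * γ)) x
        + centeredMaximal σ (fun y => u y ^ ((q - 1) * γ)) x) ^ (1 / (p - 1))
        * wolffS n p σ x := by
  have hp' : 0 ≤ 1 / (p - 1) := one_div_nonneg.2 (by linarith)
  have hm : Measurable fun t : ℝ =>
      (σ (ball x t) / ENNReal.ofReal t ^ (n - 1)) ^ (1 / (p - 1)) :=
    (((measurable_measure_ball_prod σ).comp measurable_prodMk_left).div (by fun_prop)).pow_const _
  rw [wolffG, wolffS, ← lintegral_const_mul _ hm]
  gcongr with t
  refine (le_rpow_of_gfun_eq hp hhg _).trans ?_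
  rw [← ENNReal.mul_rpow_of_nonneg _ _ hp', ← mul_div_assoc]
  gcongr
  rw [withDensity_apply _ measurableSet_ball, add_mul]
  simp only [ffun]
  rw [lintegral_add_left (hu.pow_const _)]
  gcongr <;> exact setLIntegral_ball_le_centeredMaximal_mul σ hσ _ x t

theorem rpow_le_ofReal_mul_Ffun {p q γ c : ℝ} (hp : 1 < p) (hpq : p < q) (hγ : 0 < γ)
    (hc : c = (p - 1) * γ + 1 ∨ c = (q - 1) * γ + 1) (t : ℝ≥0∞) :
    t ^ c ≤ ENNReal.ofReal c * Ffun p q γ t := by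
  have hc0 : 0 < c := by
    rcases hc with rfl | rfl
    · have : 0 < (p - 1) * γ := mul_pos (by linarith) hγ
      linarith
    · have : 0 < (q - 1) * γ := mul_pos (by linarith) hγ
      linarith
  have h1 : t ^ c / ENNReal.ofReal c ≤ Ffun p q γ t := by
    rcases hc with rfl | rfl
    · exact le_self_add
    · exact le_add_self
  rwa [ENNReal.div_le_iff' (by simpa using hc0) ENNReal.ofReal_ne_top] at h1

theorem Ffun_le_rpow_add_rpow {p q γ : ℝ} (hp : 1 < p) (hpq : p < q) (hγ : 0 < γ) (t : ℝ≥0∞) :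
    Ffun p q γ t ≤ t ^ ((p - 1) * γ + 1) + t ^ ((q - 1) * γ + 1) := by
  have hp0 : 0 < (p - 1) * γ := mul_pos (by linarith) hγ
  have hq0 : 0 < (q - 1) * γ := mul_pos (by linarith) hγ
  unfold Ffun
  gcongr <;> refine ENNReal.div_le_of_le_mul (le_mul_of_one_le_right' ?_) <;>
    · rw [ENNReal.one_le_ofReal]
      linarith

/-- Combination of Hölder's inequality with the strong type maximal inequality. -/
theorem exists_lintegral_centeredMaximal_mul_le {X : Type*} [MetricSpace X]
    [SecondCountableTopology X] [MeasurableSpace X] [BorelSpace X] [HasBesicovitchCovering X]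
    (σ : Measure X) [SFinite σ] {w : X → ℝ≥0∞} (hw : Measurable w) {e c k : ℝ} (he : 0 < e)
    (hec : e < c) (hk : 0 < k) (hek : e * k < 1)
    (hwfin : ∫⁻ x, w x ^ (c / (1 - e * k)) ∂σ < ⊤) :
    ∃ C : ℝ≥0∞, C ≠ ⊤ ∧ ∀ u : X → ℝ≥0∞, Measurable u →
      ∫⁻ x, (centeredMaximal σ (fun y => u y ^ e) x ^ k * w x) ^ c ∂σ ≤
        C * (∫⁻ x, u x ^ c ∂σ) ^ (e * k) := by
  have hδ : 0 < e * k := mul_pos he hk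
  have hδ' : 0 < 1 - e * k := by linarith
  obtain ⟨C, hC, hmax⟩ := exists_lintegral_centeredMaximal_rpow_le σ ((one_lt_div he).2 hec)
  refine ⟨C ^ (e * k) * (∫⁻ x, w x ^ (c / (1 - e * k)) ∂σ) ^ (1 - e * k),
    ENNReal.mul_ne_top (ENNReal.rpow_ne_top_of_nonneg hδ.le hC)
      (ENNReal.rpow_ne_top_of_nonneg hδ'.le hwfin.ne), fun u hu => ?_⟩
  have hc : 0 < c := he.trans hec
  calc ∫⁻ x, (centeredMaximal σ (fun y => u y ^ e) x ^ k * w x) ^ c ∂σ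
      = ∫⁻ x, (centeredMaximal σ (fun y => u y ^ e) x ^ (c / e)) ^ (e * k)
          * (w x ^ (c / (1 - e * k))) ^ (1 - e * k) ∂σ := by
        congr 1 with x
        rw [ENNReal.mul_rpow_of_nonneg _ _ hc.le, ← ENNReal.rpow_mul, ← ENNReal.rpow_mul,
          ← ENNReal.rpow_mul, div_mul_cancel₀ _ hδ'.ne']
        congr 2
        field_simp
    _ ≤ (∫⁻ x, centeredMaximal σ (fun y => u y ^ e) x ^ (c / e) ∂σ) ^ (e * k)
          * (∫⁻ x, w x ^ (c / (1 - e * k)) ∂σ) ^ (1 - e * k) :=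
        ENNReal.lintegral_mul_norm_pow_le
          ((measurable_centeredMaximal σ _).pow_const _).aemeasurable
          (hw.pow_const _).aemeasurable hδ.le hδ'.le (by ring)
    _ ≤ (C * ∫⁻ x, u x ^ c ∂σ) ^ (e * k)
          * (∫⁻ x, w x ^ (c / (1 - e * k)) ∂σ) ^ (1 - e * k) := by
        gcongr
        refine (hmax _ (hu.pow_const e)).trans_eq ?_
        simp_rw [← ENNReal.rpow_mul, mul_div_cancel₀ c he.ne']
    _ = _ := by
        rw [ENNReal.mul_rpow_of_nonneg _ _ hδ.le]
        ring

theorem ENNReal.rpow_add_mul_rpow_le (x y w : ℝ≥0∞) {k c : ℝ} (hk : 0 ≤ k) (hc : 0 ≤ c) :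
    ((x + y) ^ k * w) ^ c ≤ (2 ^ k) ^ c * 2 ^ c * ((x ^ k * w) ^ c + (y ^ k * w) ^ c) := by
  calc ((x + y) ^ k * w) ^ c ≤ (2 ^ k * (x ^ k * w + y ^ k * w)) ^ c := by
        rw [← add_mul, ← mul_assoc]
        gcongr ?_ ^ c
        gcongr ?_ * w
        exact ENNReal.add_rpow_le_two_rpow_mul x y hk
    _ = (2 ^ k) ^ c * (x ^ k * w + y ^ k * w) ^ c := ENNReal.mul_rpow_of_nonneg _ _ hc
    _ ≤ _ := by
        rw [mul_assoc]
        gcongr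
        exact ENNReal.add_rpow_le_two_rpow_mul _ _ hc

theorem exists_wolffS_lintegral_le {n : ℕ} {p q γ : ℝ} (hp : 1 < p) (hpq : p < q) (hγ0 : 0 < γ)
    {σ : Measure (EuclideanSpace ℝ (Fin n))} [SFinite σ] {e c : ℝ} (he : 0 < e) (hec : e < c)
    (he1 : e * (1 / (p - 1)) < 1)
    (hc : c = (p - 1) * γ + 1 ∨ c = (q - 1) * γ + 1)
    (hA : (∫⁻ x, Ffun p q γ (wolffS n p σ x ^ (1 / (1 - e * (1 / (p - 1))))) ∂σ) < ⊤) :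
    ∃ C : ℝ≥0∞, C ≠ ⊤ ∧ ∀ u : EuclideanSpace ℝ (Fin n) → ℝ≥0∞, Measurable u →
      ∫⁻ x, (centeredMaximal σ (fun y => u y ^ e) x ^ (1 / (p - 1)) * wolffS n p σ x) ^ c ∂σ ≤
        C * (∫⁻ x, Ffun p q γ (u x) ∂σ) ^ (e * (1 / (p - 1))) := by
  have hk : 0 < 1 / (p - 1) := one_div_pos.2 (by linarith)
  have hF : ∀ v : EuclideanSpace ℝ (Fin n) → ℝ≥0∞,
      ∫⁻ x, v x ^ c ∂σ ≤ ENNReal.ofReal c * ∫⁻ x, Ffun p q γ (v x) ∂σ := fun v => by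
    rw [← lintegral_const_mul' _ _ ENNReal.ofReal_ne_top]
    gcongr with x
    exact rpow_le_ofReal_mul_Ffun hp hpq hγ0 hc _
  obtain ⟨C, hC, h⟩ := exists_lintegral_centeredMaximal_mul_le σ (measurable_wolffS n p σ) he hec
    hk he1 (by
      refine lt_of_le_of_lt (le_of_eq_of_le ?_ (hF _)) (ENNReal.mul_lt_top (by simp) hA)
      simp_rw [← ENNReal.rpow_mul]
      congr! 3
      ring)
  have hδ : 0 ≤ e * (1 / (p - 1)) := by positivity
  refine ⟨C * ENNReal.ofReal c ^ (e * (1 / (p - 1))),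
    ENNReal.mul_ne_top hC (ENNReal.rpow_ne_top_of_nonneg hδ (by simp)), fun u hu => ?_⟩
  refine (h u hu).trans ?_
  rw [mul_assoc, ← ENNReal.mul_rpow_of_nonneg _ _ hδ]
  gcongr
  exact hF u

/-- Technical lemma: integral estimate for `F(W_G(f(u)dσ))` under condition (A). -/
theorem technical_lemma
    (n : ℕ) (hn : 3 ≤ n) (p q γ : ℝ) (hp : 1 < p) (hpq : p < q)
    (hγ0 : 0 < γ) (hγ : γ < min ((p - 1) / (q - 1)) (1 / (q - p)))
    (h : ℝ≥0∞ → ℝ≥0∞)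
    (hgh : ∀ t, h (gfun p q t) = t) (hhg : ∀ s, gfun p q (h s) = s)
    (σ : Measure (EuclideanSpace ℝ (Fin n)))
    (hσfin : ∀ (x : EuclideanSpace ℝ (Fin n)) (r : ℝ), σ (ball x r) < ⊤)
    (hA : condA n p q γ σ) :
    ∃ c : ℝ, 0 < c ∧
      ∀ u : EuclideanSpace ℝ (Fin n) → ℝ≥0∞, Measurable u →
        (∫⁻ x, Ffun p q γ (u x) ∂σ) < ⊤ →
        (∫⁻ x, Ffun p q γ (wolffG n h (σ.withDensity fun y => ffun p q γ (u y)) x) ∂σ) ≤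
          ENNReal.ofReal c *
            ((∫⁻ x, Ffun p q γ (u x) ∂σ) ^ (γ * (p - 1) / (q - 1))
              + (∫⁻ x, Ffun p q γ (u x) ∂σ) ^ γ
              + (∫⁻ x, Ffun p q γ (u x) ∂σ) ^ (γ * (q - 1) / (p - 1))) := by
  have hp0 : 0 < p - 1 := by linarith
  have hq0 : 0 < q - 1 := by linarith
  have hγ1 : γ * (q - 1) < p - 1 := (lt_div_iff₀ hq0).1 (hγ.trans_le (min_le_left _ _))
  have hγ2 : γ * (q - p) < 1 :=
    (lt_div_iff₀ (by linarith)).1 (hγ.trans_le (min_le_right _ _))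
  have : IsLocallyFiniteMeasure σ :=
    ⟨fun x => ⟨ball x 1, ball_mem_nhds x one_pos, hσfin x 1⟩⟩
  have hpγ : 0 < (p - 1) * γ := mul_pos hp0 hγ0
  have hqγ : 0 < (q - 1) * γ := mul_pos hq0 hγ0
  have hk : 0 < 1 / (p - 1) := one_div_pos.2 hp0
  have hlt : (p - 1) * γ < (q - 1) * γ := by gcongr
  have hep : (p - 1) * γ * (1 / (p - 1)) = γ := by field_simp
  have heq : (q - 1) * γ * (1 / (p - 1)) = γ * (q - 1) / (p - 1) := by ring
  have hγlt : γ < 1 := by nlinarith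
  have heq1 : γ * (q - 1) / (p - 1) < 1 := (div_lt_one hp0).2 hγ1
  have hAp : (∫⁻ x, Ffun p q γ (wolffS n p σ x ^ (1 / (1 - (p - 1) * γ * (1 / (p - 1))))) ∂σ)
      < ⊤ := by
    rw [hep]
    exact hA p (by simp) _ (by simp)
  have hAq : (∫⁻ x, Ffun p q γ (wolffS n p σ x ^ (1 / (1 - (q - 1) * γ * (1 / (p - 1))))) ∂σ)
      < ⊤ := by
    have hθ : 1 / (1 - (q - 1) * γ * (1 / (p - 1))) = (p - 1) / (p - 1 - γ * (q - 1)) := by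
      rw [heq, one_sub_div hp0.ne', one_div_div]
    rw [hθ]
    exact hA p (by simp) _ (by simp)
  obtain ⟨C₁, hC₁, h₁⟩ := exists_wolffS_lintegral_le hp hpq hγ0 (c := (p - 1) * γ + 1) hpγ
    (by linarith) (by rwa [hep]) (Or.inl rfl) hAp
  obtain ⟨C₂, hC₂, h₂⟩ := exists_wolffS_lintegral_le hp hpq hγ0 (c := (p - 1) * γ + 1) hqγ
    (by linarith) (by rwa [heq]) (Or.inl rfl) hAq
  obtain ⟨C₃, hC₃, h₃⟩ := exists_wolffS_lintegral_le hp hpq hγ0 (c := (q - 1) * γ + 1) hpγ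
    (by linarith) (by rwa [hep]) (Or.inr rfl) hAp
  obtain ⟨C₄, hC₄, h₄⟩ := exists_wolffS_lintegral_le hp hpq hγ0 (c := (q - 1) * γ + 1) hqγ
    (by linarith) (by rwa [heq]) (Or.inr rfl) hAq
  simp only [hep, heq] at h₁ h₂ h₃ h₄
  set K : ℝ → ℝ≥0∞ := fun c => (2 ^ (1 / (p - 1))) ^ c * 2 ^ c with hKdef
  have hK : ∀ c : ℝ, 0 ≤ c → K c ≠ ⊤ := fun c hc => by
    have h2 : ∀ d : ℝ, 0 ≤ d → (2 : ℝ≥0∞) ^ d ≠ ⊤ := fun d hd =>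
      ENNReal.rpow_ne_top_of_nonneg hd (by simp)
    exact ENNReal.mul_ne_top (ENNReal.rpow_ne_top_of_nonneg hc (h2 _ hk.le)) (h2 c hc)
  have hKp := hK ((p - 1) * γ + 1) (by linarith)
  have hKq := hK ((q - 1) * γ + 1) (by linarith)
  set C : ℝ≥0∞ := K ((p - 1) * γ + 1) * (C₁ + C₂) + K ((q - 1) * γ + 1) * (C₃ + C₄) with hCdef
  have hC : C ≠ ⊤ := by finiteness
  refine ⟨C.toReal + 1, by positivity, fun u hu _ => ?_⟩
  set A := ∫⁻ x, Ffun p q γ (u x) ∂σ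
  have hCle : C ≤ ENNReal.ofReal (C.toReal + 1) := by
    rw [ENNReal.le_ofReal_iff_toReal_le hC (by positivity)]
    linarith
  have hW := measurable_wolffS n p σ
  set M : ℝ → EuclideanSpace ℝ (Fin n) → ℝ≥0∞ := fun e x =>
    centeredMaximal σ (fun y => u y ^ e) x ^ (1 / (p - 1)) * wolffS n p σ x with hMdef
  have hM : ∀ e, Measurable (M e) := fun e => ((measurable_centeredMaximal σ _).pow_const _).mul hW
  set G : ℝ → EuclideanSpace ℝ (Fin n) → ℝ≥0∞ := fun c x =>
    K c * (M ((p - 1) * γ) x ^ c + M ((q - 1) * γ) x ^ c) with hGdef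
  have hG : ∀ c, Measurable (G c) := fun c =>
    (((hM _).pow_const _).add ((hM _).pow_const _)).const_mul _
  have hpoint : ∀ c : ℝ, 0 ≤ c → ∀ x,
      wolffG n h (σ.withDensity fun y => ffun p q γ (u y)) x ^ c ≤ G c x := by
    intro c hc x
    refine le_trans ?_ (ENNReal.rpow_add_mul_rpow_le _ _ _ hk.le hc)
    gcongr
    exact wolffG_withDensity_le hp hhg hσfin hu x
  have hint : ∀ c : ℝ, 0 ≤ c → ∀ D D' : ℝ≥0∞,
      (∫⁻ x, M ((p - 1) * γ) x ^ c ∂σ ≤ D * A ^ γ) →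
      (∫⁻ x, M ((q - 1) * γ) x ^ c ∂σ ≤ D' * A ^ (γ * (q - 1) / (p - 1))) →
      ∫⁻ x, G c x ∂σ ≤ K c * (D + D') * (A ^ γ + A ^ (γ * (q - 1) / (p - 1))) := by
    intro c hc D D' hD hD'
    calc ∫⁻ x, G c x ∂σ
        ≤ K c * (D * A ^ γ + D' * A ^ (γ * (q - 1) / (p - 1))) := by
          rw [hGdef, lintegral_const_mul' _ _ (hK c hc), lintegral_add_left ((hM _).pow_const _)]
          gcongr
      _ ≤ K c * ((D + D') * A ^ γ + (D + D') * A ^ (γ * (q - 1) / (p - 1))) := by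
          gcongr
          · exact le_self_add
          · exact le_add_self
      _ = _ := by ring
  calc ∫⁻ x, Ffun p q γ (wolffG n h (σ.withDensity fun y => ffun p q γ (u y)) x) ∂σ
      ≤ ∫⁻ x, (G ((p - 1) * γ + 1) x + G ((q - 1) * γ + 1) x) ∂σ := by
        gcongr with x
        exact (Ffun_le_rpow_add_rpow hp hpq hγ0 _).trans
          (add_le_add (hpoint _ (by linarith) x) (hpoint _ (by linarith) x))
    _ ≤ C * (A ^ γ + A ^ (γ * (q - 1) / (p - 1))) := by
        rw [lintegral_add_left (hG _), hCdef, add_mul]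
        exact add_le_add (hint _ (by linarith) _ _ (h₁ u hu) (h₂ u hu))
          (hint _ (by linarith) _ _ (h₃ u hu) (h₄ u hu))
    _ ≤ _ := by
        gcongr
        exact le_add_self
end
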